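/- Let F be a field and let μ = (1^{h−1}, n−h+1) be a hook partition of n with h parts. Each π̄_i preserves I_μ and so induces an operator on R_μ = F[x_1,…,x_n]/I_μ. For each subset I ⊆ {1,…,h−1}, let M_I be the F-subspace of R_μ spanned by the images of {π̄_w(x_I) : w ∈ 𝔖_n, D(w) = I}. Then these images form an F-basis of M_I, each M_I is invariant under all the induced operators π̄_i, and R_μ is the direct sum ⨁_{I ⊆ {1,…,h−1}} M_I. (Theorem 8.2: R_μ ≅ ⨁_{α ≼ μ} P_α as 0-Hecke modules, realized on the Demazure atom basis.) -/

import Mathlib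

open MvPolynomial

/-- Value of a permutation of `Fin n` as a function `ℕ → ℕ` (0 outside range). -/
def pval {n : ℕ} (w : Equiv.Perm (Fin n)) (i : ℕ) : ℕ :=
  if h : i < n then (w ⟨i, h⟩ : ℕ) else 0

/-- 0-based descent set of `w`: `i ∈ permDes w` iff `w(i) > w(i+1)`, `0 ≤ i ≤ n-2`.
(This corresponds to the 1-based descent `i+1` of the paper.) -/
def permDes {n : ℕ} (w : Equiv.Perm (Fin n)) : Finset ℕ :=
  (Finset.range (n - 1)).filter fun i => pval w (i + 1) < pval w i

/-- Number of inversions = Coxeter length of `w`. -/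
def invNum {n : ℕ} (w : Equiv.Perm (Fin n)) : ℕ :=
  (Finset.univ.filter fun p : Fin n × Fin n => p.1 < p.2 ∧ w p.2 < w p.1).card

/-- The simple transposition `s_i = (i, i+1)` (0-based); identity if out of range. -/
def sw (n : ℕ) (i : ℕ) : Equiv.Perm (Fin n) :=
  if h : i + 1 < n then Equiv.swap ⟨i, Nat.lt_of_succ_lt h⟩ ⟨i + 1, h⟩ else 1

/-- Exponent vector of `x_I = ∏_{i ∈ I} (x_0 x_1 ⋯ x_i)`. -/
def expI (n : ℕ) (I : Finset ℕ) : Fin n → ℕ := fun j => (I.filter fun i => (j : ℕ) ≤ i).card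

/-- The monomial `x_I = ∏_{i ∈ I} (x_0 x_1 ⋯ x_i)`. -/
noncomputable def xI (R : Type*) [CommRing R] (n : ℕ) (I : Finset ℕ) :
    MvPolynomial (Fin n) R :=
  ∏ j : Fin n, (X j) ^ expI n I j

/-- `λ(d)`: the decreasing rearrangement of an exponent vector. -/
def lam {n : ℕ} (d : Fin n → ℕ) : List ℕ := (List.ofFn d).insertionSort (· ≥ ·)

/-- `x^d ≺ x^e` : `λ(d)` lexicographically smaller than `λ(e)`. -/
def monLT {n : ℕ} (d e : Fin n → ℕ) : Prop := List.Lex (· < ·) (lam d) (lam e)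

/-- 0-based descent set `D(α)` of a composition `α` of `n`:
`{α_1 + ⋯ + α_j - 1 : 1 ≤ j ≤ ℓ(α) - 1}` (0-based shift of the paper's `D(α)`). -/
def compDes {n : ℕ} (c : Composition n) : Finset ℕ :=
  (Finset.range (c.length - 1)).image fun j => c.sizeUpTo (j + 1) - 1

/-- `d_k(μ) = μ′_1 + ⋯ + μ′_k`, where `μ′` is the conjugate partition of `μ`, written with
`n` parts `μ′_1 ≤ ⋯ ≤ μ′_n` (allowing zeros), so that `μ′_j = #{parts of μ ≥ n+1-j}`. -/
def dk (n : ℕ) (μ : n.Partition) (k : ℕ) : ℕ :=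
  ∑ i ∈ Finset.Icc (n + 1 - k) n, (μ.parts.filter fun p => i ≤ p).card

/-- The elementary symmetric polynomial `e_r(S)` in the set `S` of variables. -/
noncomputable def esymmS (F : Type*) [Field F] {n : ℕ} (S : Finset (Fin n)) (r : ℕ) :
    MvPolynomial (Fin n) F :=
  ∑ T ∈ S.powersetCard r, ∏ x ∈ T, X x

/-- The Tanisaki ideal `I_μ`, generated by the `e_r(S)` with `|S| = k` and
`k ≥ r > k - d_k(μ)`. -/
noncomputable def tanisaki (n : ℕ) (F : Type*) [Field F] (μ : n.Partition) :
    Ideal (MvPolynomial (Fin n) F) :=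
  Ideal.span {f : MvPolynomial (Fin n) F | ∃ (k r : ℕ) (S : Finset (Fin n)),
    S.card = k ∧ r ≤ k ∧ k - dk n μ k < r ∧ f = esymmS F S r}

/-- A partition is a hook if at most one part exceeds `1`. -/
def IsHook {n : ℕ} (μ : n.Partition) : Prop :=
  (μ.parts.filter fun p => 2 ≤ p).card ≤ 1

section Words

variable {n : ℕ}

theorem sw_of_lt {i : ℕ} (hi : i + 1 < n) :
    sw n i = Equiv.swap ⟨i, Nat.lt_of_succ_lt hi⟩ ⟨i + 1, hi⟩ := dif_pos hi

theorem sw_mul_self (n i : ℕ) : sw n i * sw n i = 1 := by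
  unfold sw
  split_ifs <;> simp

theorem sw_mul_sw_mul (i : ℕ) (w : Equiv.Perm (Fin n)) : sw n i * (sw n i * w) = w := by
  rw [← mul_assoc, sw_mul_self, one_mul]

theorem sw_inv (n i : ℕ) : (sw n i)⁻¹ = sw n i :=
  inv_eq_of_mul_eq_one_left (sw_mul_self n i)

theorem sw_apply_left {i : ℕ} (hi : i + 1 < n) :
    sw n i ⟨i, Nat.lt_of_succ_lt hi⟩ = ⟨i + 1, hi⟩ := by
  rw [sw_of_lt hi, Equiv.swap_apply_left]

theorem sw_apply_right {i : ℕ} (hi : i + 1 < n) :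
    sw n i ⟨i + 1, hi⟩ = ⟨i, Nat.lt_of_succ_lt hi⟩ := by
  rw [sw_of_lt hi, Equiv.swap_apply_right]

theorem sw_apply_of_ne {i : ℕ} {x : Fin n} (h₁ : (x : ℕ) ≠ i) (h₂ : (x : ℕ) ≠ i + 1) :
    sw n i x = x := by
  unfold sw
  split_ifs with hi
  · exact Equiv.swap_apply_of_ne_of_ne (fun h => h₁ (by rw [h])) (fun h => h₂ (by rw [h]))
  · rfl

theorem sw_lt_sw_iff {i : ℕ} {x y : Fin n} (h₁ : ¬((x : ℕ) = i ∧ (y : ℕ) = i + 1))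
    (h₂ : ¬((x : ℕ) = i + 1 ∧ (y : ℕ) = i)) : sw n i x < sw n i y ↔ x < y := by
  unfold sw
  split_ifs with hi
  · simp only [Equiv.swap_apply_def, Fin.ext_iff, Fin.lt_def]
    split_ifs <;> simp_all <;> omega
  · rfl

/-- `i` is a left ascent of `w`: the value `i` occurs to the left of the value `i + 1`. -/
def IsLeftAscent (i : ℕ) (w : Equiv.Perm (Fin n)) : Prop :=
  ∃ hi : i + 1 < n, w⁻¹ ⟨i, Nat.lt_of_succ_lt hi⟩ < w⁻¹ ⟨i + 1, hi⟩

theorem isLeftAscent_sw_mul {i : ℕ} (hi : i + 1 < n) {w : Equiv.Perm (Fin n)} :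
    IsLeftAscent i (sw n i * w) ↔ ¬ IsLeftAscent i w := by
  have : w⁻¹ ⟨i, Nat.lt_of_succ_lt hi⟩ ≠ w⁻¹ ⟨i + 1, hi⟩ := by simp
  simp only [IsLeftAscent, hi, exists_true_left, mul_inv_rev, sw_inv, Equiv.Perm.mul_apply,
    sw_apply_left hi, sw_apply_right hi, not_lt]
  exact ⟨le_of_lt, fun h => lt_of_le_of_ne h this.symm⟩

theorem IsLeftAscent.inversion_iff {i : ℕ} {w : Equiv.Perm (Fin n)} (h : IsLeftAscent i w)
    (p q : Fin n) : (p < q ∧ (sw n i * w) q < (sw n i * w) p) ↔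
      ((w p : ℕ) = i ∧ (w q : ℕ) = i + 1) ∨ (p < q ∧ w q < w p) := by
  obtain ⟨hi, h⟩ := h
  simp only [Equiv.Perm.mul_apply]
  by_cases h₁ : (w q : ℕ) = i ∧ (w p : ℕ) = i + 1
  · have e₁ : w q = ⟨i, Nat.lt_of_succ_lt hi⟩ := Fin.ext h₁.1
    have e₂ : w p = ⟨i + 1, hi⟩ := Fin.ext h₁.2
    have : q < p := by simpa [← e₁, ← e₂] using h
    simp only [this.not_gt, false_and, or_false, false_iff]
    omega
  · by_cases h₂ : (w q : ℕ) = i + 1 ∧ (w p : ℕ) = i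
    · have e₁ : w p = ⟨i, Nat.lt_of_succ_lt hi⟩ := Fin.ext h₂.2
      have e₂ : w q = ⟨i + 1, hi⟩ := Fin.ext h₂.1
      have : p < q := by simpa [← e₁, ← e₂] using h
      simp [this, e₁, e₂, sw_apply_left hi, sw_apply_right hi]
    · rw [sw_lt_sw_iff h₁ h₂]
      tauto

theorem IsLeftAscent.invNum_eq {i : ℕ} {w : Equiv.Perm (Fin n)} (h : IsLeftAscent i w) :
    invNum (sw n i * w) = invNum w + 1 := by
  obtain ⟨hi, hlt⟩ := id h
  have : (Finset.univ.filter fun p : Fin n × Fin n =>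
      p.1 < p.2 ∧ (sw n i * w) p.2 < (sw n i * w) p.1) =
      insert (w⁻¹ ⟨i, Nat.lt_of_succ_lt hi⟩, w⁻¹ ⟨i + 1, hi⟩)
        (Finset.univ.filter fun p : Fin n × Fin n => p.1 < p.2 ∧ w p.2 < w p.1) := by
    ext ⟨p, q⟩
    simp only [Finset.mem_filter, Finset.mem_univ, true_and, Finset.mem_insert, Prod.mk.injEq,
      h.inversion_iff, Equiv.Perm.eq_inv_iff_eq, Fin.ext_iff]
  rw [invNum, this, Finset.card_insert_of_notMem, invNum]
  simp

theorem invNum_eq_of_not_isLeftAscent {i : ℕ} (hi : i + 1 < n) {w : Equiv.Perm (Fin n)}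
    (h : ¬ IsLeftAscent i w) : invNum w = invNum (sw n i * w) + 1 := by
  rw [← ((isLeftAscent_sw_mul hi).2 h).invNum_eq, sw_mul_sw_mul]

theorem invNum_sw_mul_le {i : ℕ} (hi : i + 1 < n) (w : Equiv.Perm (Fin n)) :
    invNum (sw n i * w) ≤ invNum w + 1 := by
  by_cases h : IsLeftAscent i w
  · exact h.invNum_eq.le
  · have := invNum_eq_of_not_isLeftAscent hi h
    omega

/-- The permutation spelled by a word in the simple transpositions. -/
def wordProd (n : ℕ) (l : List ℕ) : Equiv.Perm (Fin n) := (l.map (sw n)).prod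

theorem wordProd_cons (i : ℕ) (l : List ℕ) : wordProd n (i :: l) = sw n i * wordProd n l := by
  simp [wordProd]

/-- A word is reduced if its length is the number of inversions of the permutation it spells. -/
def IsReducedWord (n : ℕ) (l : List ℕ) : Prop :=
  (∀ i ∈ l, i + 1 < n) ∧ l.length = invNum (wordProd n l)

theorem invNum_wordProd_le (l : List ℕ) (hl : ∀ i ∈ l, i + 1 < n) :
    invNum (wordProd n l) ≤ l.length := by
  induction l with
  | nil =>
    simp only [invNum, wordProd, List.map_nil, List.prod_nil, Equiv.Perm.one_apply,
      List.length_nil, nonpos_iff_eq_zero, Finset.card_eq_zero]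
    exact Finset.filter_eq_empty_iff.2 fun p _ h => h.1.not_gt h.2
  | cons i l ih =>
    rw [wordProd_cons, List.length_cons]
    exact (invNum_sw_mul_le (hl i (by simp)) _).trans
      (Nat.succ_le_succ (ih fun j hj => hl j (by simp [hj])))

theorem isReducedWord_cons {i : ℕ} {l : List ℕ} :
    IsReducedWord n (i :: l) ↔ IsReducedWord n l ∧ IsLeftAscent i (wordProd n l) := by
  constructor
  · rintro ⟨h₁, h₂⟩
    have hi : i + 1 < n := h₁ i (by simp)
    have hl : ∀ j ∈ l, j + 1 < n := fun j hj => h₁ j (by simp [hj])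
    have hle := invNum_wordProd_le l hl
    rw [wordProd_cons, List.length_cons] at h₂
    have hle' := invNum_sw_mul_le hi (wordProd n l)
    refine ⟨⟨hl, by omega⟩, ?_⟩
    by_contra h
    have := invNum_eq_of_not_isLeftAscent hi h
    omega
  · rintro ⟨⟨h₁, h₂⟩, h₃⟩
    refine ⟨fun j hj => ?_, ?_⟩
    · rcases List.mem_cons.1 hj with rfl | hj
      · exact h₃.1
      · exact h₁ j hj
    · rw [wordProd_cons, h₃.invNum_eq, List.length_cons, h₂]

theorem sw_mul_comm {i j : ℕ} (hij : i + 1 < j) : sw n i * sw n j = sw n j * sw n i := by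
  unfold sw
  split_ifs with h₁ h₂
  · refine (Equiv.Perm.Disjoint.commute ?_).eq
    intro x
    simp only [Equiv.swap_apply_def, Fin.ext_iff]
    split_ifs <;> simp_all
    all_goals omega
  all_goals simp

theorem sw_braid {i : ℕ} (hi : i + 2 < n) :
    sw n i * sw n (i + 1) * sw n i = sw n (i + 1) * sw n i * sw n (i + 1) := by
  have h₁ := sw_of_lt (show i + 1 < n by omega)
  have h₂ := Equiv.swap_mul_swap_mul_swap (x := (⟨i, by omega⟩ : Fin n)) (y := ⟨i + 1, by omega⟩)
    (z := ⟨i + 2, hi⟩) (by simp) (by simp)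
  have h₃ := Equiv.swap_mul_swap_mul_swap (x := (⟨i + 2, hi⟩ : Fin n)) (y := ⟨i + 1, by omega⟩)
    (z := ⟨i, by omega⟩) (by simp) (by simp)
  rw [Equiv.swap_comm, Equiv.swap_comm (⟨i + 2, _⟩ : Fin n)] at h₃
  rw [h₁, sw_of_lt hi, h₂, h₃, Equiv.swap_comm]

/-- Matsumoto's theorem: operators satisfying the braid relations depend, along a reduced word,
only on the permutation spelled by the word. -/
theorem foldr_eq_of_isReducedWord {A : Type*} (P : ℕ → A → A)
    (hex : ∀ w : Equiv.Perm (Fin n), ∃ l, IsReducedWord n l ∧ wordProd n l = w)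
    (hcomm : ∀ i j, i + 1 < j → j + 1 < n → ∀ x, P i (P j x) = P j (P i x))
    (hbraid : ∀ i, i + 2 < n → ∀ x,
      P i (P (i + 1) (P i x)) = P (i + 1) (P i (P (i + 1) x)))
    {l l' : List ℕ} (hl : IsReducedWord n l) (hl' : IsReducedWord n l')
    (h : wordProd n l = wordProd n l') (x : A) : l.foldr P x = l'.foldr P x := by
  induction hN : l.length using Nat.strong_induction_on generalizing l l' with
  | _ N ih =>
  have hlen : l.length = l'.length := by rw [hl.2, hl'.2, h]
  have key : ∀ {i j : ℕ} {u v : List ℕ}, i < j → IsReducedWord n (i :: u) →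
      IsReducedWord n (j :: v) → wordProd n (i :: u) = wordProd n (j :: v) →
      u.length + 1 = N → (i :: u).foldr P x = (j :: v).foldr P x := by
    intro i j u v hij hu hv huv hN
    have hlen : (i :: u).length = (j :: v).length := by rw [hu.2, hv.2, huv]
    simp only [List.length_cons, Nat.add_right_cancel_iff] at hlen
    obtain ⟨hu', hui⟩ := isReducedWord_cons.1 hu
    obtain ⟨hv', hvj⟩ := isReducedWord_cons.1 hv
    rw [wordProd_cons, wordProd_cons] at huv
    have huw : wordProd n u = sw n i * (sw n j * wordProd n v) := by rw [← huv, sw_mul_sw_mul]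
    have hvw : wordProd n v = sw n j * (sw n i * wordProd n u) := by rw [huv, sw_mul_sw_mul]
    obtain ⟨hj, hvj'⟩ := id hvj
    obtain ⟨hi, hui'⟩ := id hui
    rcases Nat.lt_or_ge (i + 1) j with hlt | hge
    · obtain ⟨t, ht, htw⟩ := hex (sw n i * wordProd n v)
      have e₁ : wordProd n u = wordProd n (j :: t) := by
        rw [wordProd_cons, htw, huw, ← mul_assoc, ← mul_assoc, sw_mul_comm hlt]
      have e₂ : wordProd n v = wordProd n (i :: t) := by
        rw [wordProd_cons, htw, sw_mul_sw_mul]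
      have r₁ : IsReducedWord n (i :: t) := by
        rw [isReducedWord_cons]
        refine ⟨ht, ?_⟩
        rw [htw, isLeftAscent_sw_mul hi]
        rintro ⟨_, hc⟩
        rw [hvw, mul_inv_rev, mul_inv_rev, sw_inv, sw_inv] at hc
        simp only [Equiv.Perm.mul_apply] at hc
        rw [sw_apply_of_ne (i := j) (by simp; omega) (by simp; omega),
          sw_apply_of_ne (i := j) (by simp; omega) (by simp; omega),
          sw_apply_left hi, sw_apply_right hi] at hc
        exact hc.not_gt hui'
      have r₂ : IsReducedWord n (j :: t) := by
        refine isReducedWord_cons.2 ⟨ht, hj, ?_⟩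
        rw [htw, mul_inv_rev, sw_inv]
        simp only [Equiv.Perm.mul_apply]
        rwa [sw_apply_of_ne (i := i) (by simp; omega) (by simp; omega),
          sw_apply_of_ne (i := i) (by simp; omega) (by simp; omega)]
      simp only [List.foldr_cons]
      rw [ih _ (by omega) hu' r₂ e₁ rfl, ih _ (by omega) hv' r₁ e₂ rfl]
      exact hcomm i j hlt hj _
    · obtain rfl : j = i + 1 := by omega
      obtain ⟨t, ht, htw⟩ := hex (sw n i * (sw n (i + 1) * wordProd n u))
      have e₁ : wordProd n u = wordProd n ((i + 1) :: i :: t) := by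
        rw [wordProd_cons, wordProd_cons, htw, sw_mul_sw_mul, sw_mul_sw_mul]
      have e₂ : wordProd n v = wordProd n (i :: (i + 1) :: t) := by
        have hb := sw_braid hj
        rw [wordProd_cons, wordProd_cons, htw, huw]
        calc wordProd n v = (sw n i * (sw n (i + 1) * sw n i * sw n (i + 1)) * sw n i
              * sw n (i + 1)) * wordProd n v := by
              rw [← hb]
              simp only [mul_assoc, sw_mul_sw_mul]
          _ = _ := by simp only [mul_assoc]
      have hv₁ : ∀ y, (wordProd n v)⁻¹ y
          = (wordProd n u)⁻¹ (sw n i (sw n (i + 1) y)) := by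
        intro y
        rw [hvw, mul_inv_rev, mul_inv_rev, sw_inv, sw_inv]
        rfl
      have hi₀ : sw n (i + 1) ⟨i, Nat.lt_of_succ_lt hi⟩ = ⟨i, Nat.lt_of_succ_lt hi⟩ :=
        sw_apply_of_ne (by simp) (by simp; omega)
      have hi₂ : sw n i ⟨i + 1 + 1, hj⟩ = ⟨i + 1 + 1, hj⟩ :=
        sw_apply_of_ne (by simp; omega) (by simp)
      rw [hv₁, hv₁, sw_apply_left hj, sw_apply_right hj, hi₂, sw_apply_right hi] at hvj'
      have ht₁ : ∀ y, (wordProd n t)⁻¹ y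
          = (wordProd n u)⁻¹ (sw n (i + 1) (sw n i y)) := by
        intro y
        rw [htw, mul_inv_rev, mul_inv_rev, sw_inv, sw_inv]
        rfl
      have hA : IsLeftAscent i (wordProd n t) := by
        refine ⟨hi, ?_⟩
        rw [ht₁, ht₁, sw_apply_left hi, sw_apply_right hi, sw_apply_left hj, hi₀]
        exact hvj'
      have hA' : IsLeftAscent (i + 1) (wordProd n t) := by
        refine ⟨hj, ?_⟩
        rw [ht₁, ht₁, sw_apply_right hi, hi₂, sw_apply_right hj, hi₀]
        exact hui'
      have hlt : (wordProd n t)⁻¹ ⟨i, Nat.lt_of_succ_lt hi⟩ < (wordProd n t)⁻¹ ⟨i + 1 + 1, hj⟩ :=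
        hA.2.trans hA'.2
      have r₁ : IsReducedWord n ((i + 1) :: i :: t) := by
        refine isReducedWord_cons.2 ⟨isReducedWord_cons.2 ⟨ht, hA⟩, hj, ?_⟩
        rw [wordProd_cons, mul_inv_rev, sw_inv]
        simp only [Equiv.Perm.mul_apply]
        rwa [sw_apply_right hi, hi₂]
      have r₂ : IsReducedWord n (i :: (i + 1) :: t) := by
        refine isReducedWord_cons.2 ⟨isReducedWord_cons.2 ⟨ht, hA'⟩, hi, ?_⟩
        rw [wordProd_cons, mul_inv_rev, sw_inv]
        simp only [Equiv.Perm.mul_apply]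
        rwa [sw_apply_left hj, hi₀]
      simp only [List.foldr_cons]
      rw [ih _ (by omega) hu' r₁ e₁ rfl, ih _ (by omega) hv' r₂ e₂ rfl]
      exact hbraid i hj _
  match l, l' with
  | [], [] => rfl
  | [], _ :: _ => simp at hlen
  | _ :: _, [] => simp at hlen
  | i :: u, j :: v =>
    rcases lt_trichotomy i j with hij | rfl | hij
    · exact key hij hl hl' h (by simpa using hN)
    · rw [wordProd_cons, wordProd_cons, mul_right_inj] at h
      rw [List.foldr_cons, List.foldr_cons, ih u.length (by simp at hN; omega)
        (isReducedWord_cons.1 hl).1 (isReducedWord_cons.1 hl').1 h rfl]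
    · exact (key hij hl' hl h.symm (by simpa [hlen] using hN)).symm

end Words

section Weights

variable {n : ℕ}

/-- A statistic on exponent vectors that is invariant under permutations and subadditive, with
equality exactly for vectors that can be sorted simultaneously. -/
def pairMax (e : Fin n →₀ ℕ) : ℕ := ∑ p : Fin n × Fin n, max (e p.1) (e p.2)

/-- A linear statistic on exponent vectors that prefers small indices. -/
def revSum (e : Fin n →₀ ℕ) : ℕ := ∑ i : Fin n, (n - i) * e i

theorem revSum_add (e f : Fin n →₀ ℕ) : revSum (e + f) = revSum e + revSum f := by
  simp [revSum, mul_add, Finset.sum_add_distrib]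

theorem pairMax_add_le (e f : Fin n →₀ ℕ) : pairMax (e + f) ≤ pairMax e + pairMax f := by
  rw [pairMax, pairMax, pairMax, ← Finset.sum_add_distrib]
  refine Finset.sum_le_sum fun p _ => ?_
  simp only [Finsupp.add_apply]
  omega

theorem pairMax_add_lt {e f : Fin n →₀ ℕ} {i j : Fin n} (he : e j < e i) (hf : f i < f j) :
    pairMax (e + f) < pairMax e + pairMax f := by
  rw [pairMax, pairMax, pairMax, ← Finset.sum_add_distrib]
  refine Finset.sum_lt_sum (fun p _ => ?_) ⟨(i, j), Finset.mem_univ _, ?_⟩ <;>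
  · simp only [Finsupp.add_apply]
    omega

theorem pairMax_add_eq {e f : Fin n →₀ ℕ} {w : Equiv.Perm (Fin n)} (he : Antitone (e ∘ w))
    (hf : Antitone (f ∘ w)) : pairMax (e + f) = pairMax e + pairMax f := by
  rw [pairMax, pairMax, pairMax, ← Finset.sum_add_distrib]
  refine Finset.sum_congr rfl fun p _ => ?_
  obtain ⟨a, ha⟩ := w.surjective p.1
  obtain ⟨b, hb⟩ := w.surjective p.2
  simp only [Finsupp.add_apply, ← ha, ← hb]
  rcases le_total a b with h | h
  · have h₁ : e (w b) ≤ e (w a) := he h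
    have h₂ : f (w b) ≤ f (w a) := hf h
    omega
  · have h₁ : e (w a) ≤ e (w b) := he h
    have h₂ : f (w a) ≤ f (w b) := hf h
    omega

theorem pairMax_nsmul (c : ℕ) (e : Fin n →₀ ℕ) : pairMax (c • e) = c * pairMax e := by
  simp [pairMax, Finset.mul_sum, Nat.mul_max_mul_left]

theorem pairMax_mapDomain (w : Equiv.Perm (Fin n)) (e : Fin n →₀ ℕ) :
    pairMax (e.mapDomain w) = pairMax e := by
  simp only [pairMax, Finsupp.mapDomain_equiv_apply]
  exact Equiv.sum_comp (Equiv.prodCongr w.symm w.symm)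
    (fun p : Fin n × Fin n => max (e p.1) (e p.2))

/-- Move `t` units of the exponent at `i` to the exponent at `j`. -/
noncomputable def moveExp (m : Fin n →₀ ℕ) (i j : Fin n) (t : ℕ) : Fin n →₀ ℕ :=
  m - Finsupp.single i t + Finsupp.single j t

theorem moveExp_apply_left (m : Fin n →₀ ℕ) {i j : Fin n} (hij : i ≠ j) (t : ℕ) :
    moveExp m i j t i = m i - t := by
  simp [moveExp, hij]

theorem moveExp_apply_right (m : Fin n →₀ ℕ) {i j : Fin n} (hij : i ≠ j) (t : ℕ) :
    moveExp m i j t j = m j + t := by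
  simp [moveExp, hij.symm]

theorem moveExp_apply_of_ne (m : Fin n →₀ ℕ) {i j x : Fin n} (hi : x ≠ i) (hj : x ≠ j) (t : ℕ) :
    moveExp m i j t x = m x := by
  simp [moveExp, hi.symm, hj.symm]

theorem moveExp_sub_eq_mapDomain_swap {m : Fin n →₀ ℕ} {i j : Fin n} (hij : i ≠ j)
    (h : m j ≤ m i) : moveExp m i j (m i - m j) = m.mapDomain (Equiv.swap i j) := by
  ext x
  rw [Finsupp.mapDomain_equiv_apply, Equiv.symm_swap]
  rcases eq_or_ne x i with rfl | hi
  · rw [moveExp_apply_left m hij, Equiv.swap_apply_left]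
    omega
  rcases eq_or_ne x j with rfl | hj
  · rw [moveExp_apply_right m hij, Equiv.swap_apply_right]
    omega
  · rw [moveExp_apply_of_ne m hi hj, Equiv.swap_apply_of_ne_of_ne hi hj]

theorem pairMax_moveExp_lt {m : Fin n →₀ ℕ} {i j : Fin n} (hij : i ≠ j) {t : ℕ} (ht : 0 < t)
    (h : m j + t < m i) : pairMax (moveExp m i j t) < pairMax m := by
  obtain ⟨d, hd⟩ : ∃ d, m i = m j + t + d := ⟨m i - (m j + t), by omega⟩
  have hd0 : 0 < d := by omega
  have e : (t + d) • moveExp m i j t = d • m + t • m.mapDomain (Equiv.swap i j) := by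
    ext x
    simp only [Finsupp.smul_apply, Finsupp.add_apply, smul_eq_mul, Finsupp.mapDomain_equiv_apply,
      Equiv.symm_swap]
    rcases eq_or_ne x i with rfl | hi
    · rw [moveExp_apply_left m hij, Equiv.swap_apply_left, hd,
        show m j + t + d - t = m j + d by omega]
      ring
    rcases eq_or_ne x j with rfl | hj
    · rw [moveExp_apply_right m hij, Equiv.swap_apply_right, hd]
      ring
    · rw [moveExp_apply_of_ne m hi hj, Equiv.swap_apply_of_ne_of_ne hi hj]
      ring
  have hlt : pairMax (d • m + t • m.mapDomain (Equiv.swap i j)) <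
      pairMax (d • m) + pairMax (t • m.mapDomain (Equiv.swap i j)) := by
    refine pairMax_add_lt (i := i) (j := j) ?_ ?_
    · simp only [Finsupp.smul_apply, smul_eq_mul]
      exact Nat.mul_lt_mul_of_pos_left (by omega) hd0
    · simp only [Finsupp.smul_apply, smul_eq_mul, Finsupp.mapDomain_equiv_apply,
        Equiv.symm_swap, Equiv.swap_apply_left, Equiv.swap_apply_right]
      exact Nat.mul_lt_mul_of_pos_left (by omega) ht
  rw [← e, pairMax_nsmul, pairMax_nsmul, pairMax_nsmul, pairMax_mapDomain, ← add_mul,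
    add_comm d] at hlt
  exact lt_of_mul_lt_mul_left' hlt

theorem pairMax_moveExp_le {m : Fin n →₀ ℕ} {i j : Fin n} (hij : i ≠ j) {t : ℕ}
    (h : m j + t ≤ m i) : pairMax (moveExp m i j t) ≤ pairMax m := by
  rcases Nat.eq_zero_or_pos t with rfl | ht
  · simp [moveExp]
  rcases h.lt_or_eq with h | h
  · exact (pairMax_moveExp_lt hij ht h).le
  · rw [show t = m i - m j by omega, moveExp_sub_eq_mapDomain_swap hij (by omega),
      pairMax_mapDomain]

theorem card_support_le_moveExp {m : Fin n →₀ ℕ} {i j : Fin n} (hij : i ≠ j) {t : ℕ}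
    (h : m j + t ≤ m i) : m.support.card ≤ (moveExp m i j t).support.card := by
  rcases Nat.eq_zero_or_pos (m i - t) with h0 | h0
  · rw [show t = m i - m j by omega, moveExp_sub_eq_mapDomain_swap hij (by omega),
      Finsupp.mapDomain_support_of_injective (Equiv.injective _),
      Finset.card_image_of_injective _ (Equiv.injective _)]
  · refine Finset.card_le_card fun x hx => ?_
    rw [Finsupp.mem_support_iff] at hx ⊢
    rcases eq_or_ne x i with rfl | hi
    · rw [moveExp_apply_left m hij]
      omega
    rcases eq_or_ne x j with rfl | hj
    · rw [moveExp_apply_right m hij]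
      omega
    · rwa [moveExp_apply_of_ne m hi hj]

/-- The exponent vector of the squarefree monomial `∏ x ∈ T, X x`. -/
noncomputable def indExp (T : Finset (Fin n)) : Fin n →₀ ℕ := ∑ x ∈ T, Finsupp.single x 1

theorem indExp_apply (T : Finset (Fin n)) (x : Fin n) : indExp T x = if x ∈ T then 1 else 0 := by
  simp [indExp, Finsupp.single_apply]

theorem support_indExp (T : Finset (Fin n)) : (indExp T).support = T := by
  ext x
  simp [indExp_apply]

theorem pairMax_indExp (T : Finset (Fin n)) : pairMax (indExp T) = n ^ 2 - (n - T.card) ^ 2 := by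
  have : ∀ p : Fin n × Fin n, max (indExp T p.1) (indExp T p.2) =
      if p ∈ (Tᶜ ×ˢ Tᶜ)ᶜ then 1 else 0 := by
    intro p
    simp only [indExp_apply, Finset.mem_compl, Finset.mem_product]
    split_ifs <;> simp_all
  rw [pairMax, Finset.sum_congr rfl fun p _ => this p, Finset.sum_boole]
  rw [Nat.cast_id, Finset.filter_mem_eq_inter, Finset.univ_inter, Finset.card_compl,
    Finset.card_product, Finset.card_compl, Fintype.card_prod, Fintype.card_fin, sq, sq]

theorem revSum_indExp (T : Finset (Fin n)) : revSum (indExp T) = ∑ i ∈ T, (n - i) := by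
  simp [revSum, indExp_apply]

/-- If `T` has the size of the initial segment `w '' {p | p < k}` of a stable sorting `w` of `g`,
and `indExp T` can be sorted together with `g`, then `T` has smaller `revSum`. -/
theorem revSum_indExp_lt {g : Fin n →₀ ℕ} {w : Equiv.Perm (Fin n)} (hg : Antitone (g ∘ w))
    (hw : ∀ p q, p < q → g (w p) = g (w q) → w p < w q) {k : ℕ} {T T₀ : Finset (Fin n)}
    (hT₀ : ∀ p, w p ∈ T₀ ↔ (p : ℕ) < k) (hcard : T.card = T₀.card) (hne : T ≠ T₀)
    (hT : ∀ i ∈ T, ∀ j ∉ T, g j ≤ g i) : revSum (indExp T) < revSum (indExp T₀) := by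
  have hlt : ∀ i ∈ T \ T₀, ∀ j ∈ T₀ \ T, j < i := by
    intro i hi j hj
    rw [Finset.mem_sdiff] at hi hj
    obtain ⟨p, rfl⟩ := w.surjective i
    obtain ⟨q, rfl⟩ := w.surjective j
    rw [hT₀] at hi hj
    have hqp : q < p := by
      rw [Fin.lt_def]
      omega
    exact hw q p hqp (le_antisymm (hT _ hi.1 _ hj.2) (hg hqp.le))
  have hc : (T \ T₀).card = (T₀ \ T).card := Finset.card_sdiff_comm hcard
  have hpos : (T \ T₀).Nonempty := by
    rw [Finset.nonempty_iff_ne_empty, Ne, Finset.sdiff_eq_empty_iff_subset]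
    exact fun hs => hne (Finset.eq_of_subset_of_card_le hs hcard.ge)
  have hmin := (T \ T₀).min'_mem hpos
  set t := (T \ T₀).min' hpos
  rw [revSum_indExp, revSum_indExp, ← Finset.sum_inter_add_sum_sdiff T T₀,
    ← Finset.sum_inter_add_sum_sdiff T₀ T, Finset.inter_comm T₀]
  refine Nat.add_lt_add_left ?_ _
  calc ∑ i ∈ T \ T₀, (n - (i : ℕ)) ≤ (T \ T₀).card • (n - (t : ℕ)) := by
        refine Finset.sum_le_card_nsmul _ _ _ fun i hi => ?_
        have : t ≤ i := Finset.min'_le _ _ hi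
        rw [Fin.le_def] at this
        omega
    _ < (T₀ \ T).card • (n - (t : ℕ) + 1) := by
        rw [hc, smul_eq_mul, smul_eq_mul]
        exact Nat.mul_lt_mul_of_pos_left (Nat.lt_succ_self _) (hc ▸ hpos.card_pos)
    _ ≤ ∑ i ∈ T₀ \ T, (n - (i : ℕ)) := by
        refine Finset.card_nsmul_le_sum _ _ _ fun j hj => ?_
        have := hlt t hmin j hj
        rw [Fin.lt_def] at this
        omega

end Weights

section Demazure

theorem braid_of_divided_difference {R : Type*} [CommRing R] [IsDomain R] (s₁ s₂ : R →+* R)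
    (D₁ D₂ : R → R) (x y z : R) (hxy : x - y ≠ 0) (hyz : y - z ≠ 0) (hxz : x - z ≠ 0)
    (h₁x : s₁ x = y) (h₁y : s₁ y = x) (h₁z : s₁ z = z)
    (h₂x : s₂ x = x) (h₂y : s₂ y = z) (h₂z : s₂ z = y)
    (h₁ : ∀ f, s₁ (s₁ f) = f) (h₂ : ∀ f, s₂ (s₂ f) = f)
    (hs : ∀ f, s₁ (s₂ (s₁ f)) = s₂ (s₁ (s₂ f)))
    (hD₁ : ∀ f, (x - y) * D₁ f = y * (f - s₁ f)) (hD₂ : ∀ f, (y - z) * D₂ f = z * (f - s₂ f))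
    (f : R) : D₁ (D₂ (D₁ f)) = D₂ (D₁ (D₂ f)) := by
  have h₁D₁ : ∀ f, (y - x) * s₁ (D₁ f) = x * (s₁ f - f) := fun f => by
    simpa [h₁x, h₁y, h₁] using congrArg s₁ (hD₁ f)
  have h₂D₂ : ∀ f, (z - y) * s₂ (D₂ f) = y * (s₂ f - f) := fun f => by
    simpa [h₂z, h₂y, h₂] using congrArg s₂ (hD₂ f)
  have h₂D₁ : ∀ f, (x - z) * s₂ (D₁ f) = z * (s₂ f - s₂ (s₁ f)) := fun f => by
    simpa [h₂x, h₂y] using congrArg s₂ (hD₁ f)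
  have h₁D₂ : ∀ f, (x - z) * s₁ (D₂ f) = z * (s₁ f - s₁ (s₂ f)) := fun f => by
    simpa [h₁z, h₁y] using congrArg s₁ (hD₂ f)
  have h₁₂D₁ : ∀ f, (y - z) * s₁ (s₂ (D₁ f)) = z * (s₁ (s₂ f) - s₁ (s₂ (s₁ f))) := fun f => by
    simpa [h₁z, h₁x] using congrArg s₁ (h₂D₁ f)
  have h₂₁D₂ : ∀ f, (x - y) * s₂ (s₁ (D₂ f)) = y * (s₂ (s₁ f) - s₁ (s₂ (s₁ f))) := fun f => by
    simpa [h₂z, h₂x, hs] using congrArg s₂ (h₁D₂ f)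
  refine mul_left_cancel₀
    (mul_ne_zero (mul_ne_zero (pow_ne_zero 2 hxy) (pow_ne_zero 2 hyz)) hxz) ?_
  linear_combination (x - y) * (y - z) ^ 2 * (x - z) * hD₁ (D₂ (D₁ f))
    + (x - y) * (y - z) * (x - z) * y * hD₂ (D₁ f) - (x - y) * (y - z) ^ 2 * y * h₁D₂ (D₁ f)
    + (y - z) * (x - z) * y * z * hD₁ f - (x - y) * (y - z) * y * z * h₂D₁ f
    + (y - z) ^ 2 * y * z * h₁D₁ f + (x - y) * (y - z) * y * z * h₁₂D₁ f
    - (x - y) ^ 2 * (y - z) * (x - z) * hD₂ (D₁ (D₂ f))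
    - (x - y) * (y - z) * (x - z) * z * hD₁ (D₂ f) + (x - y) ^ 2 * (y - z) * z * h₂D₁ (D₂ f)
    - (x - y) * (x - z) * y * z * hD₂ f + (x - y) * (y - z) * y * z * h₁D₂ f
    - (x - y) ^ 2 * z ^ 2 * h₂D₂ f - (x - y) * (y - z) * z ^ 2 * h₂₁D₂ f

variable {n : ℕ} {F : Type*} [Field F] {dem : ℕ → MvPolynomial (Fin n) F → MvPolynomial (Fin n) F}

/-- The property characterizing the Demazure operators `π_i`. -/
def IsDemazure (dem : ℕ → MvPolynomial (Fin n) F → MvPolynomial (Fin n) F) : Prop :=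
  ∀ (i : ℕ) (hi : i + 1 < n) (f : MvPolynomial (Fin n) F),
    (X (⟨i, Nat.lt_of_succ_lt hi⟩ : Fin n) - X ⟨i + 1, hi⟩) * dem i f
      = X (⟨i, Nat.lt_of_succ_lt hi⟩ : Fin n) * f - X ⟨i + 1, hi⟩ * rename (sw n i) f

/-- The operators `π̄_i = π_i - 1`. -/
noncomputable def demBar (dem : ℕ → MvPolynomial (Fin n) F → MvPolynomial (Fin n) F) (i : ℕ)
    (f : MvPolynomial (Fin n) F) : MvPolynomial (Fin n) F := dem i f - f

theorem X_sub_X_ne_zero {i j : Fin n} (hij : i ≠ j) :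
    (X i - X j : MvPolynomial (Fin n) F) ≠ 0 :=
  sub_ne_zero.2 fun h => hij (X_injective h)

theorem rename_sw_rename_sw (i : ℕ) (f : MvPolynomial (Fin n) F) :
    rename (sw n i) (rename (sw n i) f) = f := by
  rw [rename_rename, ← Equiv.Perm.coe_mul, sw_mul_self, Equiv.Perm.coe_one, rename_id_apply]

namespace IsDemazure

variable (hdem : IsDemazure dem) {i : ℕ} (hi : i + 1 < n)
include hdem hi

theorem mul_demBar (f : MvPolynomial (Fin n) F) :
    (X (⟨i, Nat.lt_of_succ_lt hi⟩ : Fin n) - X ⟨i + 1, hi⟩) * demBar dem i f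
      = X ⟨i + 1, hi⟩ * (f - rename (sw n i) f) := by
  rw [demBar, mul_sub, hdem i hi]
  ring

theorem demBar_eq_of_mul_eq {f g : MvPolynomial (Fin n) F}
    (h : (X (⟨i, Nat.lt_of_succ_lt hi⟩ : Fin n) - X ⟨i + 1, hi⟩) * g
      = X ⟨i + 1, hi⟩ * (f - rename (sw n i) f)) : demBar dem i f = g :=
  mul_left_cancel₀ (X_sub_X_ne_zero (by simp)) ((hdem.mul_demBar hi f).trans h.symm)

theorem demBar_add (f g : MvPolynomial (Fin n) F) :
    demBar dem i (f + g) = demBar dem i f + demBar dem i g := by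
  refine hdem.demBar_eq_of_mul_eq hi ?_
  rw [mul_add, hdem.mul_demBar hi, hdem.mul_demBar hi, map_add]
  ring

theorem demBar_mul_of_rename_eq {e : MvPolynomial (Fin n) F} (he : rename (sw n i) e = e)
    (f : MvPolynomial (Fin n) F) : demBar dem i (e * f) = e * demBar dem i f := by
  refine hdem.demBar_eq_of_mul_eq hi ?_
  rw [mul_left_comm, hdem.mul_demBar hi, map_mul, he]
  ring

theorem demBar_rename (f : MvPolynomial (Fin n) F) :
    demBar dem i (rename (sw n i) f) = - demBar dem i f := by
  refine hdem.demBar_eq_of_mul_eq hi ?_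
  rw [mul_neg, hdem.mul_demBar hi, rename_sw_rename_sw]
  ring

theorem demBar_demBar (f : MvPolynomial (Fin n) F) :
    demBar dem i (demBar dem i f) = - demBar dem i f := by
  refine hdem.demBar_eq_of_mul_eq hi ?_
  refine mul_left_cancel₀ (X_sub_X_ne_zero (F := F) (i := (⟨i, Nat.lt_of_succ_lt hi⟩ : Fin n))
    (j := ⟨i + 1, hi⟩) (by simp)) ?_
  have h₁ := hdem.mul_demBar hi f
  have h₂ := congrArg (rename (sw n i)) h₁
  simp only [map_mul, map_sub, rename_X, sw_apply_left hi, sw_apply_right hi,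
    rename_sw_rename_sw] at h₂
  set x : MvPolynomial (Fin n) F := X ⟨i, Nat.lt_of_succ_lt hi⟩
  set y : MvPolynomial (Fin n) F := X ⟨i + 1, hi⟩
  linear_combination -(x - y) * h₁ - y * h₁ - y * h₂

/-- `π̄_i` as a linear map. -/
noncomputable def demBarLinearMap : MvPolynomial (Fin n) F →ₗ[F] MvPolynomial (Fin n) F where
  toFun := demBar dem i
  map_add' := hdem.demBar_add hi
  map_smul' c f := by
    rw [smul_eq_C_mul, hdem.demBar_mul_of_rename_eq hi (rename_C _ _), smul_eq_C_mul,
      RingHom.id_apply]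

@[simp]
theorem demBarLinearMap_apply (f : MvPolynomial (Fin n) F) :
    hdem.demBarLinearMap hi f = demBar dem i f := rfl

theorem demBar_monomial {m : Fin n →₀ ℕ}
    (h : m ⟨i + 1, hi⟩ ≤ m ⟨i, Nat.lt_of_succ_lt hi⟩) :
    demBar dem i (monomial m 1) =
      ∑ t ∈ Finset.range (m ⟨i, Nat.lt_of_succ_lt hi⟩ - m ⟨i + 1, hi⟩),
        monomial (moveExp m ⟨i, Nat.lt_of_succ_lt hi⟩ ⟨i + 1, hi⟩ (t + 1)) 1 := by
  have key : ∀ d ≤ m ⟨i, Nat.lt_of_succ_lt hi⟩,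
      (X (⟨i, Nat.lt_of_succ_lt hi⟩ : Fin n) - X ⟨i + 1, hi⟩) * ∑ t ∈ Finset.range d,
        (monomial (moveExp m ⟨i, Nat.lt_of_succ_lt hi⟩ ⟨i + 1, hi⟩ (t + 1)) 1
          : MvPolynomial (Fin n) F) = X ⟨i + 1, hi⟩ * (monomial m 1 -
        monomial (moveExp m ⟨i, Nat.lt_of_succ_lt hi⟩ ⟨i + 1, hi⟩ d) 1) := by
    intro d hd
    induction d with
    | zero => simp [moveExp]
    | succ d ih =>
      rw [Finset.sum_range_succ, mul_add, ih (by omega)]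
      have : (X (⟨i, Nat.lt_of_succ_lt hi⟩ : Fin n) : MvPolynomial (Fin n) F) *
          monomial (moveExp m ⟨i, Nat.lt_of_succ_lt hi⟩ ⟨i + 1, hi⟩ (d + 1)) 1 =
          X ⟨i + 1, hi⟩ *
          monomial (moveExp m ⟨i, Nat.lt_of_succ_lt hi⟩ ⟨i + 1, hi⟩ d) 1 := by
        rw [X, X, monomial_mul, monomial_mul]
        congr 2
        ext x
        simp only [moveExp, Finsupp.add_apply, Finsupp.tsub_apply, Finsupp.single_apply]
        split_ifs with h₁ h₂ h₂
        · rw [← h₂] at h₁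
          simp at h₁
        · subst h₁
          omega
        · omega
        · omega
      linear_combination this
  refine hdem.demBar_eq_of_mul_eq hi ?_
  rw [key _ (Nat.sub_le _ _), moveExp_sub_eq_mapDomain_swap (by simp) h, rename_monomial,
    sw_of_lt hi]

theorem demBar_monomial_eq_zero {m : Fin n →₀ ℕ}
    (h : m ⟨i, Nat.lt_of_succ_lt hi⟩ = m ⟨i + 1, hi⟩) : demBar dem i (monomial m 1) = 0 := by
  rw [hdem.demBar_monomial hi h.ge, h, Nat.sub_self, Finset.sum_range_zero]

theorem demBar_monomial_sub_mem {m : Fin n →₀ ℕ}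
    (h : m ⟨i + 1, hi⟩ < m ⟨i, Nat.lt_of_succ_lt hi⟩) :
    demBar dem i (monomial m 1) - monomial (m.mapDomain (sw n i)) 1 ∈
      restrictSupport F {e | pairMax e < pairMax m} := by
  obtain ⟨d, hd⟩ : ∃ d, m ⟨i, Nat.lt_of_succ_lt hi⟩ - m ⟨i + 1, hi⟩ = d + 1 :=
    ⟨m ⟨i, Nat.lt_of_succ_lt hi⟩ - m ⟨i + 1, hi⟩ - 1, by omega⟩
  rw [hdem.demBar_monomial hi h.le, hd, Finset.sum_range_succ, ← hd,
    moveExp_sub_eq_mapDomain_swap (by simp) h.le, sw_of_lt hi, add_sub_cancel_right]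
  refine Submodule.sum_mem _ fun t ht => ?_
  rw [Finset.mem_range] at ht
  exact (monomial_mem_restrictSupport F).2
    (Or.inl (pairMax_moveExp_lt (by simp) (Nat.succ_pos t) (by omega)))

theorem demBar_mem_restrictSupport {S : Set (Fin n →₀ ℕ)}
    (hS : ∀ m ∈ S, ∀ i j t, i ≠ j → m j + t ≤ m i → moveExp m i j t ∈ S)
    {f : MvPolynomial (Fin n) F} (hf : f ∈ restrictSupport F S) :
    demBar dem i f ∈ restrictSupport F S := by
  have key : ∀ m ∈ S, m ⟨i + 1, hi⟩ ≤ m ⟨i, Nat.lt_of_succ_lt hi⟩ →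
      demBar dem i (monomial m 1) ∈ restrictSupport F S := by
    intro m hm h
    rw [hdem.demBar_monomial hi h]
    refine Submodule.sum_mem _ fun t ht => (monomial_mem_restrictSupport F).2 (Or.inl ?_)
    rw [Finset.mem_range] at ht
    exact hS m hm _ _ _ (by simp) (by omega)
  suffices h : restrictSupport F S ≤ (restrictSupport F S).comap (hdem.demBarLinearMap hi) from
    h hf
  conv_lhs => rw [restrictSupport_eq_span]
  rw [Submodule.span_le]
  rintro _ ⟨m, hm, rfl⟩
  simp only [Submodule.comap_coe, Set.mem_preimage, demBarLinearMap_apply, SetLike.mem_coe]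
  rcases le_total (m ⟨i + 1, hi⟩) (m ⟨i, Nat.lt_of_succ_lt hi⟩) with h | h
  · exact key m hm h
  · have hsw : m.mapDomain (sw n i) = moveExp m ⟨i + 1, hi⟩ ⟨i, Nat.lt_of_succ_lt hi⟩
        (m ⟨i + 1, hi⟩ - m ⟨i, Nat.lt_of_succ_lt hi⟩) := by
      rw [moveExp_sub_eq_mapDomain_swap (by simp) h, Equiv.swap_comm, sw_of_lt hi]
    rw [← neg_neg (demBar dem i _), ← hdem.demBar_rename hi, rename_monomial]
    refine Submodule.neg_mem _ (key _ ?_ ?_)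
    · rw [hsw]
      exact hS m hm _ _ _ (by simp) (by omega)
    · rw [Finsupp.mapDomain_equiv_apply, Finsupp.mapDomain_equiv_apply, ← Equiv.Perm.coe_inv,
        sw_inv, sw_apply_left hi, sw_apply_right hi]
      exact h

omit hi

theorem demBar_comm {i j : ℕ} (hij : i + 1 < j) (hj : j + 1 < n) (f : MvPolynomial (Fin n) F) :
    demBar dem i (demBar dem j f) = demBar dem j (demBar dem i f) := by
  have hi : i + 1 < n := by omega
  have hcomm : rename (sw n i) (rename (sw n j) f) = rename (sw n j) (rename (sw n i) f) := by
    rw [rename_rename, rename_rename, ← Equiv.Perm.coe_mul, ← Equiv.Perm.coe_mul,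
      sw_mul_comm hij]
  have hx : ∀ k (hk : k + 1 < n) (g : MvPolynomial (Fin n) F) l,
      (k + 1 < l ∨ l + 1 < k) →
      (X (⟨k, Nat.lt_of_succ_lt hk⟩ : Fin n) - X ⟨k + 1, hk⟩) * rename (sw n l) (demBar dem k g)
        = X ⟨k + 1, hk⟩ * (rename (sw n l) g - rename (sw n l) (rename (sw n k) g)) := by
    intro k hk g l hkl
    have := congrArg (rename (sw n l)) (hdem.mul_demBar hk g)
    simp only [map_mul, map_sub, rename_X] at this
    rwa [sw_apply_of_ne (by simp; omega) (by simp; omega),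
      sw_apply_of_ne (by simp; omega) (by simp; omega)] at this
  refine mul_left_cancel₀ (mul_ne_zero
    (X_sub_X_ne_zero (F := F) (i := (⟨i, Nat.lt_of_succ_lt hi⟩ : Fin n)) (j := ⟨i + 1, hi⟩)
      (by simp))
    (X_sub_X_ne_zero (F := F) (i := (⟨j, Nat.lt_of_succ_lt hj⟩ : Fin n)) (j := ⟨j + 1, hj⟩)
      (by simp))) ?_
  have h₁ := hdem.mul_demBar hi (demBar dem j f)
  have h₂ := hdem.mul_demBar hj (demBar dem i f)
  have h₃ := hx j hj f i (by omega)
  have h₄ := hx i hi f j (by omega)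
  have h₅ := hdem.mul_demBar hi f
  have h₆ := hdem.mul_demBar hj f
  rw [hcomm] at h₃
  set x : MvPolynomial (Fin n) F := X ⟨i, Nat.lt_of_succ_lt hi⟩
  set y : MvPolynomial (Fin n) F := X ⟨i + 1, hi⟩
  set x' : MvPolynomial (Fin n) F := X ⟨j, Nat.lt_of_succ_lt hj⟩
  set y' : MvPolynomial (Fin n) F := X ⟨j + 1, hj⟩
  linear_combination (x' - y') * h₁ + y * h₆ - y * h₃ - (x - y) * h₂ - y' * h₅ + y' * h₄

theorem demBar_braid {i : ℕ} (hi : i + 2 < n) (f : MvPolynomial (Fin n) F) :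
    demBar dem i (demBar dem (i + 1) (demBar dem i f)) =
      demBar dem (i + 1) (demBar dem i (demBar dem (i + 1) f)) := by
  have hi' : i + 1 < n := by omega
  refine braid_of_divided_difference (rename (sw n i) : _ →ₐ[F] _).toRingHom
    (rename (sw n (i + 1)) : _ →ₐ[F] _).toRingHom _ _
    (X ⟨i, by omega⟩) (X ⟨i + 1, by omega⟩) (X ⟨i + 2, hi⟩) (X_sub_X_ne_zero (by simp))
    (X_sub_X_ne_zero (by simp)) (X_sub_X_ne_zero (by simp)) ?_ ?_ ?_ ?_ ?_ ?_
    (rename_sw_rename_sw i) (rename_sw_rename_sw (i + 1)) ?_ (hdem.mul_demBar hi')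
    (hdem.mul_demBar hi) f
  · simp [sw_apply_left hi']
  · simp [sw_apply_right hi']
  · simp [sw_apply_of_ne]
  · have := sw_apply_of_ne (n := n) (i := i + 1) (x := ⟨i, by omega⟩) (by simp) (by simp; omega)
    simp [this]
  · simp [sw_apply_left hi]
  · simp [sw_apply_right hi]
  · intro g
    have := congrArg (fun w : Equiv.Perm (Fin n) => rename w g) (sw_braid hi)
    simpa [rename_rename, Function.comp_assoc] using this

end IsDemazure

end Demazure

section Atoms

variable {n : ℕ}

theorem mem_permDes {w : Equiv.Perm (Fin n)} {k : ℕ} :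
    k ∈ permDes w ↔ ∃ hk : k + 1 < n, w ⟨k + 1, hk⟩ < w ⟨k, Nat.lt_of_succ_lt hk⟩ := by
  rw [permDes, Finset.mem_filter, Finset.mem_range]
  unfold pval
  constructor
  · rintro ⟨h₁, h₂⟩
    have hk : k + 1 < n := by omega
    rw [dif_pos hk, dif_pos (by omega)] at h₂
    exact ⟨hk, h₂⟩
  · rintro ⟨hk, h⟩
    rw [dif_pos hk, dif_pos (by omega)]
    exact ⟨by omega, h⟩

theorem exists_mem_permDes {w : Equiv.Perm (Fin n)} {p q : Fin n} (hpq : p < q)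
    (h : w q < w p) : ∃ k ∈ permDes w, (p : ℕ) ≤ k ∧ k < q := by
  by_contra! hc
  have key : ∀ r : ℕ, (p : ℕ) ≤ r → ∀ hr : r ≤ q, w p ≤ w ⟨r, hr.trans_lt q.2⟩ := by
    intro r hpr
    induction r, hpr using Nat.le_induction with
    | base => exact fun _ => le_rfl
    | succ r hpr ih =>
      intro hr
      refine (ih (by omega)).trans (not_lt.1 fun hlt => ?_)
      have := hc r (mem_permDes.2 ⟨hr.trans_lt q.2, hlt⟩) hpr
      omega
  exact h.not_ge (key q hpq.le le_rfl)

/-- The exponent vector of `x_I`. -/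
noncomputable def desExp (n : ℕ) (I : Finset ℕ) : Fin n →₀ ℕ :=
  Finsupp.equivFunOnFinite.symm (expI n I)

theorem desExp_apply (I : Finset ℕ) (j : Fin n) :
    desExp n I j = (I.filter fun i => (j : ℕ) ≤ i).card := rfl

theorem xI_eq_monomial (F : Type*) [CommRing F] (I : Finset ℕ) :
    xI F n I = monomial (desExp n I) 1 := by
  rw [monomial_eq, map_one, one_mul, Finsupp.prod_fintype _ _ fun i => pow_zero _]
  rfl

theorem desExp_antitone (I : Finset ℕ) : Antitone (desExp n I) := by
  intro p q hpq
  rw [desExp_apply, desExp_apply]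
  refine Finset.card_le_card (Finset.monotone_filter_right _ fun k _ hk => ?_)
  exact le_trans (Fin.le_def.1 hpq) hk

theorem desExp_lt {I : Finset ℕ} {p q : Fin n} {k : ℕ} (hk : k ∈ I) (hp : (p : ℕ) ≤ k)
    (hq : k < q) : desExp n I q < desExp n I p := by
  rw [desExp_apply, desExp_apply]
  refine Finset.card_lt_card (Finset.ssubset_iff_of_subset
    (Finset.monotone_filter_right _ fun l _ hl => ?_) |>.2 ⟨k, ?_, ?_⟩)
  · exact (hp.trans hq.le).trans hl
  · simp [hk, hp]
  · simp [hq]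

theorem desExp_succ {I : Finset ℕ} {k : ℕ} (hk : k + 1 < n) :
    desExp n I ⟨k, Nat.lt_of_succ_lt hk⟩ =
      desExp n I ⟨k + 1, hk⟩ + if k ∈ I then 1 else 0 := by
  simp only [desExp_apply]
  split_ifs with h
  · rw [← Finset.card_insert_of_notMem (a := k) (by simp)]
    congr 1
    ext l
    simp only [Finset.mem_filter, Finset.mem_insert]
    constructor
    · rintro ⟨h₁, h₂⟩
      rcases h₂.eq_or_lt with h₃ | h₃
      · exact Or.inl h₃.symm
      · exact Or.inr ⟨h₁, h₃⟩
    · rintro (rfl | ⟨h₁, h₂⟩)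
      · exact ⟨h, le_rfl⟩
      · exact ⟨h₁, by omega⟩
  · rw [add_zero]
    congr 1
    refine Finset.filter_congr fun l hl => ?_
    have : l ≠ k := fun h' => h (h' ▸ hl)
    show k ≤ l ↔ k + 1 ≤ l
    omega

theorem desExp_lt_of_inversion {w : Equiv.Perm (Fin n)} {p q : Fin n} (hpq : p < q)
    (h : w q < w p) : desExp n (permDes w) q < desExp n (permDes w) p := by
  obtain ⟨k, hk, hp, hq⟩ := exists_mem_permDes hpq h
  exact desExp_lt hk hp hq

variable {F : Type*} [Field F] {dem : ℕ → MvPolynomial (Fin n) F → MvPolynomial (Fin n) F}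

theorem IsDemazure.foldr_demBar_sub_mem (hdem : IsDemazure dem) {l : List ℕ}
    (hl : IsReducedWord n l) {d : Fin n →₀ ℕ}
    (hd : ∀ p q, p < q → wordProd n l q < wordProd n l p → d q < d p) :
    l.foldr (demBar dem) (monomial d 1) - monomial (d.mapDomain (wordProd n l)) 1 ∈
      restrictSupport F {e | pairMax e < pairMax d} := by
  induction l with
  | nil =>
    have : d.mapDomain (wordProd n []) = d := Finsupp.mapDomain_id
    simp [this]
  | cons i l ih =>
    obtain ⟨hl, ha⟩ := isReducedWord_cons.1 hl
    obtain ⟨hi, hlt⟩ := id ha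
    have hinv := ha.inversion_iff
    rw [wordProd_cons] at hd ⊢
    have h₁ := ih hl fun p q hpq h => hd p q hpq ((hinv p q).2 (Or.inr ⟨hpq, h⟩)).2
    have hS : ∀ m ∈ {e : Fin n →₀ ℕ | pairMax e < pairMax d}, ∀ i j t, i ≠ j → m j + t ≤ m i →
        moveExp m i j t ∈ {e : Fin n →₀ ℕ | pairMax e < pairMax d} :=
      fun m hm i j t hij ht => (pairMax_moveExp_le hij ht).trans_lt hm
    have h₂ := hdem.demBar_mem_restrictSupport hi hS h₁
    have hlt' := hd _ _ hlt ((hinv _ _).2 (Or.inl (by simp))).2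
    have h₃ := hdem.demBar_monomial_sub_mem hi (m := d.mapDomain (wordProd n l))
      (by rw [Finsupp.mapDomain_equiv_apply, Finsupp.mapDomain_equiv_apply]; exact hlt')
    rw [pairMax_mapDomain] at h₃
    have h₄ := Submodule.add_mem _ h₂ h₃
    rw [← hdem.demBarLinearMap_apply hi, map_sub, demBarLinearMap_apply, demBarLinearMap_apply,
      sub_add_sub_cancel, ← Finsupp.mapDomain_comp, ← Equiv.Perm.coe_mul] at h₄
    exact h₄

/-- `a` is the family of Demazure atoms `π̄_w(x_{D(w)})`. -/
def IsAtomFamily (dem : ℕ → MvPolynomial (Fin n) F → MvPolynomial (Fin n) F)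
    (a : Equiv.Perm (Fin n) → MvPolynomial (Fin n) F) : Prop :=
  ∀ w : Equiv.Perm (Fin n), ∃ l : List ℕ, IsReducedWord n l ∧ wordProd n l = w ∧
    a w = l.foldr (demBar dem) (xI F n (permDes w))

variable {a : Equiv.Perm (Fin n) → MvPolynomial (Fin n) F}

theorem IsAtomFamily.sub_mem (ha : IsAtomFamily dem a) (hdem : IsDemazure dem)
    (w : Equiv.Perm (Fin n)) :
    a w - monomial ((desExp n (permDes w)).mapDomain w) 1 ∈
      restrictSupport F {e | pairMax e < pairMax ((desExp n (permDes w)).mapDomain w)} := by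
  obtain ⟨l, hl, rfl, haw⟩ := ha w
  rw [haw, xI_eq_monomial, pairMax_mapDomain]
  exact hdem.foldr_demBar_sub_mem hl fun p q => desExp_lt_of_inversion

theorem IsAtomFamily.eq_foldr (ha : IsAtomFamily dem a) (hdem : IsDemazure dem) {l : List ℕ}
    (hl : IsReducedWord n l) :
    a (wordProd n l) = l.foldr (demBar dem) (xI F n (permDes (wordProd n l))) := by
  obtain ⟨l', hl', hw, haw⟩ := ha (wordProd n l)
  rw [haw]
  refine foldr_eq_of_isReducedWord _ (fun w => ?_) ?_ ?_ hl' hl hw _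
  · obtain ⟨t, ht, htw, _⟩ := ha w
    exact ⟨t, ht, htw⟩
  · exact fun i j hij hj => hdem.demBar_comm hij hj
  · exact fun i hi => hdem.demBar_braid hi

theorem permDes_sw_mul_of_ne {i : ℕ} {w : Equiv.Perm (Fin n)} (hi : i + 1 < n)
    (hlt : IsLeftAscent i w) (hne : permDes (sw n i * w) ≠ permDes w) :
    ∃ p ∉ permDes w, p + 1 < n ∧ sw n i * w = w * sw n p := by
  obtain ⟨k, hk⟩ : ∃ k, ¬ (k ∈ permDes (sw n i * w) ↔ k ∈ permDes w) := by
    by_contra! h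
    exact hne (Finset.ext h)
  have hkn : k + 1 < n := by
    by_contra hkn
    simp only [mem_permDes, hkn, IsEmpty.exists_iff, not_true_eq_false] at hk
  have h := hlt.inversion_iff ⟨k, Nat.lt_of_succ_lt hkn⟩ ⟨k + 1, hkn⟩
  have hlt' : (⟨k, Nat.lt_of_succ_lt hkn⟩ : Fin n) < ⟨k + 1, hkn⟩ := by simp
  simp only [hlt', true_and] at h
  simp only [mem_permDes, hkn, exists_true_left, h] at hk
  obtain ⟨h₁, h₂⟩ : ((w ⟨k, Nat.lt_of_succ_lt hkn⟩ : ℕ) = i ∧ (w ⟨k + 1, hkn⟩ : ℕ) = i + 1) ∧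
    ¬ (w ⟨k + 1, hkn⟩ < w ⟨k, Nat.lt_of_succ_lt hkn⟩) := by tauto
  refine ⟨k, fun hmem => h₂ (mem_permDes.1 hmem).2, hkn, ?_⟩
  have e₁ : w ⟨k, Nat.lt_of_succ_lt hkn⟩ = ⟨i, Nat.lt_of_succ_lt hi⟩ := Fin.ext h₁.1
  have e₂ : w ⟨k + 1, hkn⟩ = ⟨i + 1, hi⟩ := Fin.ext h₁.2
  rw [sw_of_lt hi, sw_of_lt hkn, ← e₁, ← e₂, Equiv.mul_swap_eq_swap_mul]

theorem IsAtomFamily.demBar_mem_span (ha : IsAtomFamily dem a) (hdem : IsDemazure dem) {i : ℕ}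
    (hi : i + 1 < n) (w : Equiv.Perm (Fin n)) :
    demBar dem i (a w) ∈ Submodule.span F (a '' {v | permDes v = permDes w}) := by
  by_cases hasc : IsLeftAscent i w
  · obtain ⟨l, hl, rfl, haw⟩ := ha w
    have hred : IsReducedWord n (i :: l) := isReducedWord_cons.2 ⟨hl, hasc⟩
    by_cases hD : permDes (sw n i * wordProd n l) = permDes (wordProd n l)
    · have h := ha.eq_foldr hdem hred
      rw [wordProd_cons, hD, List.foldr_cons, ← haw] at h
      rw [← h]
      exact Submodule.subset_span ⟨_, hD, rfl⟩
    · obtain ⟨p, hp, hpn, hsw⟩ := permDes_sw_mul_of_ne hi hasc hD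
      have hprod : wordProd n (l ++ [p]) = wordProd n (i :: l) := by
        rw [wordProd_cons, hsw]
        simp [wordProd]
      have hred' : IsReducedWord n (l ++ [p]) := by
        refine ⟨fun j hj => ?_, ?_⟩
        · rcases List.mem_append.1 hj with hj | hj
          · exact hl.1 j hj
          · rw [List.mem_singleton.1 hj]
            exact hpn
        · rw [hprod, ← hred.2]
          simp
      have hex : ∀ w : Equiv.Perm (Fin n), ∃ l, IsReducedWord n l ∧ wordProd n l = w := fun w => by
        obtain ⟨t, ht, htw, _⟩ := ha w
        exact ⟨t, ht, htw⟩
      have h := foldr_eq_of_isReducedWord (demBar dem) hex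
        (fun i j hij hj => hdem.demBar_comm hij hj) (fun i hi => hdem.demBar_braid hi)
        hred hred' hprod.symm (xI F n (permDes (wordProd n l)))
      rw [List.foldr_cons, ← haw, List.foldr_append, List.foldr_cons, List.foldr_nil,
        xI_eq_monomial, hdem.demBar_monomial_eq_zero hpn (by rw [desExp_succ hpn, if_neg hp]; rfl)]
        at h
      rw [h]
      have h0 : ∀ t : List ℕ, (∀ j ∈ t, j + 1 < n) → t.foldr (demBar dem) 0 = 0 := by
        intro t ht
        induction t with
        | nil => rfl
        | cons j t ih =>
          rw [List.foldr_cons, ih fun k hk => ht k (by simp [hk]),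
            ← hdem.demBarLinearMap_apply (ht j (by simp)), map_zero]
      rw [h0 l hl.1]
      exact Submodule.zero_mem _
  · obtain ⟨l, hl, hlw, -⟩ := ha (sw n i * w)
    have hred : IsReducedWord n (i :: l) :=
      isReducedWord_cons.2 ⟨hl, by rwa [hlw, isLeftAscent_sw_mul hi]⟩
    have hw : wordProd n (i :: l) = w := by rw [wordProd_cons, hlw, sw_mul_sw_mul]
    have h := ha.eq_foldr hdem hred
    rw [hw, List.foldr_cons] at h
    rw [h, hdem.demBar_demBar hi, ← h]
    exact Submodule.neg_mem _ (Submodule.subset_span ⟨w, rfl, rfl⟩)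

end Atoms

section Leading

open scoped Pointwise in
theorem mul_mem_restrictSupport {σ R : Type*} [CommSemiring R] {S T U : Set (σ →₀ ℕ)}
    {p q : MvPolynomial σ R} (hp : p ∈ restrictSupport R S) (hq : q ∈ restrictSupport R T)
    (h : ∀ a ∈ S, ∀ b ∈ T, a + b ∈ U) : p * q ∈ restrictSupport R U := by
  refine restrictSupport_mono R (Set.add_subset_iff.2 h) ?_
  rw [restrictSupport_add]
  exact Submodule.mul_mem_mul hp hq

variable {n : ℕ} {F : Type*} [Field F]

/-- The exponents that are dominated by `f` in a product with leading exponent `g + f`. -/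
def lowExp (g f : Fin n →₀ ℕ) : Set (Fin n →₀ ℕ) :=
  {m | pairMax m ≤ pairMax f ∧ (pairMax (g + m) < pairMax g + pairMax f ∨ revSum m < revSum f)}

/-- `q` has leading exponent `f`, sorted by `w`, relative to `g`. -/
def HasLead (w : Equiv.Perm (Fin n)) (g f : Fin n →₀ ℕ) (q : MvPolynomial (Fin n) F) : Prop :=
  Antitone (f ∘ w) ∧ q - monomial f 1 ∈ restrictSupport F (lowExp g f)

namespace HasLead

variable {w : Equiv.Perm (Fin n)} {g f f₁ f₂ : Fin n →₀ ℕ} {q q₁ q₂ : MvPolynomial (Fin n) F}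

theorem one : HasLead w g 0 (1 : MvPolynomial (Fin n) F) :=
  ⟨fun _ _ _ => le_rfl, by simp⟩

theorem mul (h₁ : HasLead w g f₁ q₁) (h₂ : HasLead w g f₂ q₂) :
    HasLead w g (f₁ + f₂) (q₁ * q₂) := by
  have hadd := pairMax_add_eq h₁.1 h₂.1
  refine ⟨h₁.1.add h₂.1, ?_⟩
  have e : q₁ * q₂ - monomial (f₁ + f₂) 1 =
      (q₁ - monomial f₁ 1) * (q₂ - monomial f₂ 1) +
        (monomial f₁ 1 * (q₂ - monomial f₂ 1) + monomial f₂ 1 * (q₁ - monomial f₁ 1)) := by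
    rw [show monomial (f₁ + f₂) (1 : F) = monomial f₁ 1 * monomial f₂ 1 by
      rw [monomial_mul, one_mul]]
    ring
  have hmon : ∀ f : Fin n →₀ ℕ, monomial f (1 : F) ∈ restrictSupport F {f} := fun f =>
    (monomial_mem_restrictSupport F).2 (Or.inl rfl)
  rw [e]
  refine Submodule.add_mem _ (mul_mem_restrictSupport h₁.2 h₂.2 ?_) (Submodule.add_mem _
    (mul_mem_restrictSupport (hmon f₁) h₂.2 ?_) (mul_mem_restrictSupport (hmon f₂) h₁.2 ?_))
  · rintro m ⟨hm, hm'⟩ m' ⟨hm₁, hm₁'⟩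
    have h₁ := pairMax_add_le m m'
    have h₂ := pairMax_add_le (g + m) m'
    have h₃ := pairMax_add_le (g + m') m
    rw [add_right_comm, add_assoc] at h₃
    rw [add_assoc] at h₂
    simp only [lowExp, Set.mem_ofPred_eq, revSum_add, hadd]
    omega
  · rintro m (rfl : m = f₁) m' ⟨hm₁, hm₁'⟩
    have h₁ := pairMax_add_le m m'
    have h₃ := pairMax_add_le (g + m') m
    rw [add_right_comm, add_assoc] at h₃
    simp only [lowExp, Set.mem_ofPred_eq, revSum_add, hadd]
    omega
  · rintro m (rfl : m = f₂) m' ⟨hm₁, hm₁'⟩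
    have h₁ := pairMax_add_le m m'
    have h₃ := pairMax_add_le (g + m') m
    rw [add_right_comm, add_assoc] at h₃
    simp only [lowExp, Set.mem_ofPred_eq, revSum_add, hadd]
    omega

theorem pow (h : HasLead w g f q) (c : ℕ) : HasLead w g (c • f) (q ^ c) := by
  induction c with
  | zero => simpa using one
  | succ c ih => simpa only [succ_nsmul, pow_succ] using ih.mul h

theorem prod {ι : Type*} (s : Finset ι) {f : ι → Fin n →₀ ℕ} {q : ι → MvPolynomial (Fin n) F}
    (h : ∀ i ∈ s, HasLead w g (f i) (q i)) : HasLead w g (∑ i ∈ s, f i) (∏ i ∈ s, q i) := by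
  classical
  induction s using Finset.induction_on with
  | empty => simpa using one
  | insert i s hi ih =>
    rw [Finset.sum_insert hi, Finset.prod_insert hi]
    exact (h i (by simp)).mul (ih fun j hj => h j (by simp [hj]))

end HasLead

theorem esymmS_eq_sum_monomial (S : Finset (Fin n)) (r : ℕ) :
    esymmS F S r = ∑ T ∈ S.powersetCard r, monomial (indExp T) 1 := by
  refine Finset.sum_congr rfl fun T _ => ?_
  rw [indExp, monomial_sum_one]
  rfl

/-- The image under `w` of the first `k` indices. -/
def topSet (w : Equiv.Perm (Fin n)) (k : ℕ) : Finset (Fin n) :=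
  Finset.univ.filter fun x => (w.symm x : ℕ) < k

theorem apply_mem_topSet {w : Equiv.Perm (Fin n)} {k : ℕ} {p : Fin n} :
    w p ∈ topSet w k ↔ (p : ℕ) < k := by
  simp [topSet]

theorem card_topSet (w : Equiv.Perm (Fin n)) {k : ℕ} (hk : k ≤ n) : (topSet w k).card = k := by
  have : topSet w k = (Finset.univ.filter fun p : Fin n => (p : ℕ) < k).map w.toEmbedding := by
    ext x
    obtain ⟨p, rfl⟩ := w.surjective x
    simp [topSet]
  rw [this, Finset.card_map, Fin.card_filter_val_lt]
  omega

/-- `w` sorts `g` into decreasing order, keeping the order of equal entries. -/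
def IsStableSort (w : Equiv.Perm (Fin n)) (g : Fin n →₀ ℕ) : Prop :=
  Antitone (g ∘ w) ∧ ∀ p q, p < q → g (w p) = g (w q) → w p < w q

theorem IsStableSort.hasLead_esymmS {w : Equiv.Perm (Fin n)} {g : Fin n →₀ ℕ}
    (hw : IsStableSort w g) {k : ℕ} (hk : k ≤ n) :
    HasLead w g (indExp (topSet w k)) (esymmS F Finset.univ k) := by
  have hmem : topSet w k ∈ (Finset.univ : Finset (Fin n)).powersetCard k := by
    simp [Finset.mem_powersetCard, card_topSet w hk]
  refine ⟨fun p q hpq => ?_, ?_⟩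
  · simp only [Function.comp_apply, indExp_apply, apply_mem_topSet]
    rw [Fin.le_def] at hpq
    split_ifs <;> omega
  · rw [esymmS_eq_sum_monomial, ← Finset.add_sum_erase _ _ hmem, add_sub_cancel_left]
    refine Submodule.sum_mem _ fun T hT => (monomial_mem_restrictSupport F).2 (Or.inl ?_)
    rw [Finset.mem_erase, Finset.mem_powersetCard] at hT
    have hpm : pairMax (indExp T) = pairMax (indExp (topSet w k)) := by
      rw [pairMax_indExp, pairMax_indExp, hT.2.2, card_topSet w hk]
    refine ⟨hpm.le, or_iff_not_imp_left.2 fun hlt => ?_⟩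
    refine revSum_indExp_lt hw.1 hw.2 (fun p => apply_mem_topSet) (by
      rw [hT.2.2, card_topSet w hk]) hT.1 fun i hi j hj => not_lt.1 fun hij => hlt ?_
    rw [← hpm]
    exact pairMax_add_lt (i := j) (j := i) hij (by simp [indExp_apply, hi, hj])

/-- The product of powers of the elementary symmetric polynomials of degrees `1, …, k`. -/
noncomputable def symProd (F : Type*) [Field F] (n : ℕ) {k : ℕ} (ν : Fin k → ℕ) :
    MvPolynomial (Fin n) F :=
  ∏ r : Fin k, esymmS F Finset.univ (r + 1) ^ ν r

/-- The leading exponent of `symProd F n ν` after sorting by `w`. -/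
noncomputable def symExp (w : Equiv.Perm (Fin n)) {k : ℕ} (ν : Fin k → ℕ) : Fin n →₀ ℕ :=
  ∑ r : Fin k, ν r • indExp (topSet w (r + 1))

theorem IsStableSort.hasLead_symProd {w : Equiv.Perm (Fin n)} {g : Fin n →₀ ℕ}
    (hw : IsStableSort w g) {k : ℕ} (hk : k ≤ n) (ν : Fin k → ℕ) :
    HasLead w g (symExp w ν) (symProd F n ν) :=
  HasLead.prod Finset.univ fun r _ => (hw.hasLead_esymmS (r.2.trans_le hk)).pow (ν r)

/-- The leading exponent of `a w * symProd F n ν`. -/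
noncomputable def ldExp (w : Equiv.Perm (Fin n)) {k : ℕ} (ν : Fin k → ℕ) : Fin n →₀ ℕ :=
  (desExp n (permDes w)).mapDomain w + symExp w ν

/-- Exponents are compared by `pairMax`, then by `revSum`. -/
def expRank (m : Fin n →₀ ℕ) : ℕ ×ₗ ℕ := toLex (pairMax m, revSum m)

theorem isStableSort_mapDomain_desExp (w : Equiv.Perm (Fin n)) :
    IsStableSort w ((desExp n (permDes w)).mapDomain w) := by
  have h : ∀ p, (desExp n (permDes w)).mapDomain w (w p) = desExp n (permDes w) p := fun p => by
    rw [Finsupp.mapDomain_equiv_apply, Equiv.symm_apply_apply]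
  refine ⟨fun p q hpq => ?_, fun p q hpq he => ?_⟩
  · simp only [Function.comp_apply, h]
    exact desExp_antitone _ hpq
  · rw [h, h] at he
    refine (w.injective.ne hpq.ne).lt_or_gt.resolve_right fun hlt => ?_
    exact (desExp_lt_of_inversion hpq hlt).ne' he

theorem IsAtomFamily.mul_symProd_sub_mem {dem : ℕ → MvPolynomial (Fin n) F → MvPolynomial (Fin n) F}
    {a : Equiv.Perm (Fin n) → MvPolynomial (Fin n) F} (ha : IsAtomFamily dem a)
    (hdem : IsDemazure dem) (w : Equiv.Perm (Fin n)) {k : ℕ} (hk : k ≤ n) (ν : Fin k → ℕ) :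
    a w * symProd F n ν - monomial (ldExp w ν) 1 ∈
      restrictSupport F {m | expRank m < expRank (ldExp w ν)} := by
  have hs := isStableSort_mapDomain_desExp w
  have hq := hs.hasLead_symProd (F := F) hk ν
  have hadd := pairMax_add_eq hs.1 hq.1
  have h₁ := ha.sub_mem hdem w
  rw [ldExp]
  set g := (desExp n (permDes w)).mapDomain w
  set f := symExp w ν
  set q := symProd F n ν
  have e : a w * q - monomial (g + f) 1 =
      (a w - monomial g 1) * (q - monomial f 1) +
        (monomial g 1 * (q - monomial f 1) + monomial f 1 * (a w - monomial g 1)) := by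
    rw [show monomial (g + f) (1 : F) = monomial g 1 * monomial f 1 by
      rw [monomial_mul, one_mul]]
    ring
  have hmon : ∀ f : Fin n →₀ ℕ, monomial f (1 : F) ∈ restrictSupport F {f} := fun f =>
    (monomial_mem_restrictSupport F).2 (Or.inl rfl)
  rw [e]
  refine Submodule.add_mem _ (mul_mem_restrictSupport h₁ hq.2 ?_) (Submodule.add_mem _
    (mul_mem_restrictSupport (hmon g) hq.2 ?_) (mul_mem_restrictSupport (hmon f) h₁ ?_))
  · rintro m hm m' ⟨hm₁, hm₁'⟩
    rw [Set.mem_ofPred_eq] at hm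
    have h₁ := pairMax_add_le m m'
    simp only [expRank, Set.mem_ofPred_eq, Prod.Lex.toLex_lt_toLex, hadd]
    omega
  · rintro _ rfl m' ⟨hm₁, hm₁'⟩
    have h₁ := pairMax_add_le g m'
    simp only [expRank, Set.mem_ofPred_eq, Prod.Lex.toLex_lt_toLex, hadd, revSum_add]
    omega
  · rintro _ rfl m hm
    rw [Set.mem_ofPred_eq] at hm
    have h₁ := pairMax_add_le f m
    simp only [expRank, Set.mem_ofPred_eq, Prod.Lex.toLex_lt_toLex, hadd]
    omega

end Leading

section Index

variable {n : ℕ} {w : Equiv.Perm (Fin n)} {g : Fin n →₀ ℕ}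

theorem isStableSort_iff : IsStableSort w g ↔ w = Tuple.sort (OrderDual.toDual ∘ g) := by
  rw [Tuple.eq_sort_iff]
  exact Iff.rfl

theorem IsStableSort.lt_of_mem_permDes (hw : IsStableSort w g) {k : ℕ} (hk : k + 1 < n)
    (h : k ∈ permDes w) : g (w ⟨k + 1, hk⟩) < g (w ⟨k, Nat.lt_of_succ_lt hk⟩) := by
  have hlt : (⟨k, Nat.lt_of_succ_lt hk⟩ : Fin n) < ⟨k + 1, hk⟩ := by simp
  obtain ⟨_, h⟩ := mem_permDes.1 h
  exact (hw.1 hlt.le).lt_of_ne fun he => h.not_gt (hw.2 _ _ hlt he.symm)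

theorem IsStableSort.apply_eq_zero (hw : IsStableSort w g) {p : Fin n}
    (hp : g.support.card ≤ p) : g (w p) = 0 := by
  by_contra h0
  have hsub : (Finset.Iic p).map w.toEmbedding ⊆ g.support := fun x hx => by
    obtain ⟨q, hq, rfl⟩ := Finset.mem_map.1 hx
    have : g (w p) ≤ g (w q) := hw.1 (Finset.mem_Iic.1 hq)
    rw [Finsupp.mem_support_iff, Equiv.coe_toEmbedding]
    omega
  have := Finset.card_le_card hsub
  rw [Finset.card_map, Fin.card_Iic] at this
  omega

variable {k : ℕ}

theorem symExp_apply (w : Equiv.Perm (Fin n)) (ν : Fin k → ℕ) (p : Fin n) :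
    symExp w ν (w p) = ∑ r : Fin k, if (p : ℕ) ≤ r then ν r else 0 := by
  simp [symExp, Finsupp.finsetSum_apply, indExp_apply, apply_mem_topSet]

theorem ldExp_apply (w : Equiv.Perm (Fin n)) (ν : Fin k → ℕ) (p : Fin n) :
    ldExp w ν (w p) = desExp n (permDes w) p + ∑ r : Fin k, if (p : ℕ) ≤ r then ν r else 0 := by
  rw [ldExp, Finsupp.add_apply, symExp_apply, Finsupp.mapDomain_equiv_apply,
    Equiv.symm_apply_apply]

theorem isStableSort_ldExp (w : Equiv.Perm (Fin n)) (ν : Fin k → ℕ) :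
    IsStableSort w (ldExp w ν) := by
  have hsum : ∀ p q : Fin n, p ≤ q → (∑ r : Fin k, if (q : ℕ) ≤ r then ν r else 0) ≤
      ∑ r : Fin k, if (p : ℕ) ≤ r then ν r else 0 := by
    refine fun p q hpq => Finset.sum_le_sum fun r _ => ?_
    rw [Fin.le_def] at hpq
    split_ifs <;> omega
  refine ⟨fun p q hpq => ?_, fun p q hpq he => ?_⟩
  · simp only [Function.comp_apply, ldExp_apply]
    exact Nat.add_le_add (desExp_antitone _ hpq) (hsum p q hpq)
  · rw [ldExp_apply, ldExp_apply] at he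
    refine (w.injective.ne hpq.ne).lt_or_gt.resolve_right fun hlt => ?_
    have h₁ := desExp_lt_of_inversion hpq hlt
    have h₂ := hsum p q hpq.le
    omega

theorem ldExp_apply_of_le (hD : permDes w ⊆ Finset.range k) (ν : Fin k → ℕ) {p : Fin n}
    (hp : k ≤ p) : ldExp w ν (w p) = 0 := by
  rw [ldExp_apply, desExp_apply, Nat.add_eq_zero_iff, Finset.card_eq_zero,
    Finset.filter_eq_empty_iff]
  refine ⟨fun l hl => ?_, Finset.sum_eq_zero fun r _ => if_neg (by omega)⟩
  have := Finset.mem_range.1 (hD hl)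
  omega

theorem ldExp_apply_succ (hk : k < n) (w : Equiv.Perm (Fin n)) (ν : Fin k → ℕ) (r : Fin k) :
    ldExp w ν (w ⟨r, by omega⟩) =
      ldExp w ν (w ⟨r + 1, by omega⟩) + (if (r : ℕ) ∈ permDes w then 1 else 0) + ν r := by
  have hsum : (∑ s : Fin k, if (r : ℕ) ≤ s then ν s else 0) =
      (∑ s : Fin k, if (r : ℕ) + 1 ≤ s then ν s else 0) + ν r := by
    have hr : (∑ s : Fin k, if s = r then ν s else 0) = ν r := by simp
    rw [← hr, ← Finset.sum_add_distrib]
    refine Finset.sum_congr rfl fun s _ => ?_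
    simp only [Fin.ext_iff]
    split_ifs <;> omega
  rw [ldExp_apply, ldExp_apply, desExp_succ (by omega)]
  simp only [hsum]
  omega

theorem ldExp_injective (hk : k < n) {v : Equiv.Perm (Fin n)} {ν ξ : Fin k → ℕ}
    (h : ldExp v ν = ldExp w ξ) : v = w ∧ ν = ξ := by
  have hvw : v = w := by
    rw [isStableSort_iff.1 (isStableSort_ldExp v ν), h]
    exact (isStableSort_iff.1 (isStableSort_ldExp w ξ)).symm
  subst hvw
  refine ⟨rfl, funext fun r => ?_⟩
  have h₁ := ldExp_apply_succ hk v ν r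
  have h₂ := ldExp_apply_succ hk v ξ r
  rw [h] at h₁
  omega

theorem card_support_ldExp_le (hk : k ≤ n) (hD : permDes w ⊆ Finset.range k) (ν : Fin k → ℕ) :
    (ldExp w ν).support.card ≤ k := by
  refine (Finset.card_le_card fun x hx => ?_).trans (card_topSet w hk).le
  obtain ⟨p, rfl⟩ := w.surjective x
  rw [apply_mem_topSet]
  by_contra hp
  exact Finsupp.mem_support_iff.1 hx (ldExp_apply_of_le hD ν (not_lt.1 hp))

theorem exists_ldExp_eq (hk : k < n) (hg : g.support.card ≤ k) :
    ∃ (w : Equiv.Perm (Fin n)) (ν : Fin k → ℕ),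
      permDes w ⊆ Finset.range k ∧ ldExp w ν = g := by
  obtain ⟨w, hw⟩ : ∃ w, IsStableSort w g := ⟨_, isStableSort_iff.2 rfl⟩
  have hD : permDes w ⊆ Finset.range k := fun r hr => by
    obtain ⟨hrn, -⟩ := mem_permDes.1 hr
    have hlt := hw.lt_of_mem_permDes hrn hr
    rw [Finset.mem_range]
    by_contra hrk
    rw [hw.apply_eq_zero (p := ⟨r, Nat.lt_of_succ_lt hrn⟩) (by simp only; omega)] at hlt
    exact Nat.not_lt_zero _ hlt
  refine ⟨w, fun r => g (w ⟨r, by omega⟩) - g (w ⟨r + 1, by omega⟩) -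
    if (r : ℕ) ∈ permDes w then 1 else 0, hD, ?_⟩
  set ν : Fin k → ℕ := fun r => g (w ⟨r, by omega⟩) - g (w ⟨r + 1, by omega⟩) -
    if (r : ℕ) ∈ permDes w then 1 else 0 with hν
  have key : ∀ j p : ℕ, ∀ hp : p < n, k ≤ p + j → ldExp w ν (w ⟨p, hp⟩) = g (w ⟨p, hp⟩) := by
    intro j
    induction j with
    | zero =>
      intro p hp hkp
      rw [ldExp_apply_of_le hD ν (p := ⟨p, hp⟩) hkp,
        hw.apply_eq_zero (p := ⟨p, hp⟩) (hg.trans hkp)]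
    | succ j ih =>
      intro p hp hkp
      by_cases hpk : k ≤ p
      · exact ih p hp (by omega)
      · have h₁ := ldExp_apply_succ hk w ν ⟨p, by omega⟩
        have h₂ := ih (p + 1) (by omega) (by omega)
        have h₃ : g (w ⟨p + 1, by omega⟩) ≤ g (w ⟨p, hp⟩) := hw.1 (by simp [Fin.le_def])
        rw [h₁, h₂, hν]
        simp only
        split_ifs with hmem
        · have := hw.lt_of_mem_permDes (by omega) hmem
          omega
        · omega
  ext x
  obtain ⟨p, rfl⟩ := w.surjective x
  exact key k p p.2 (by omega)

end Index

section Triangular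

variable {ι σ R α : Type*} [CommRing R] [LinearOrder α] {ld : ι → σ →₀ ℕ} {rk : (σ →₀ ℕ) → α}
  {b : ι → MvPolynomial σ R}

theorem span_range_sup_restrictSupport_eq_top [WellFoundedLT α]
    (hb : ∀ p, b p - monomial (ld p) 1 ∈ restrictSupport R {m | rk m < rk (ld p)}) :
    Submodule.span R (Set.range b) ⊔ restrictSupport R (Set.range ld)ᶜ = ⊤ := by
  have key : ∀ (c : α) (m : σ →₀ ℕ), rk m = c → monomial m (1 : R) ∈
      Submodule.span R (Set.range b) ⊔ restrictSupport R (Set.range ld)ᶜ := by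
    intro c
    induction c using WellFoundedLT.induction with
    | ind c ih =>
      rintro m rfl
      by_cases hm : m ∈ Set.range ld
      · obtain ⟨p, rfl⟩ := hm
        rw [← sub_sub_self (b p) (monomial (ld p) 1)]
        refine Submodule.sub_mem _ (Submodule.mem_sup_left (Submodule.subset_span ⟨p, rfl⟩)) ?_
        have hle : restrictSupport R {m | rk m < rk (ld p)} ≤
            Submodule.span R (Set.range b) ⊔ restrictSupport R (Set.range ld)ᶜ := by
          rw [restrictSupport_eq_span, Submodule.span_le]
          rintro _ ⟨m, hm, rfl⟩
          exact ih _ hm m rfl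
        exact hle (hb p)
      · exact Submodule.mem_sup_right ((monomial_mem_restrictSupport R).2 (Or.inl hm))
  rw [eq_top_iff, ← restrictSupport_univ R, restrictSupport_eq_span, Submodule.span_le]
  rintro _ ⟨m, -, rfl⟩
  exact key _ m rfl

theorem coeff_eq_zero_of_mem_restrictSupport {S : Set (σ →₀ ℕ)} {f : MvPolynomial σ R}
    (hf : f ∈ restrictSupport R S) {m : σ →₀ ℕ} (hm : m ∉ S) : coeff m f = 0 := by
  by_contra h
  exact hm (hf (mem_support_iff.2 h))

theorem eq_zero_of_linearCombination_mem_restrictSupport (hld : Function.Injective ld)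
    (hb : ∀ p, b p - monomial (ld p) 1 ∈ restrictSupport R {m | rk m < rk (ld p)})
    {c : ι →₀ R} (hc : Finsupp.linearCombination R b c ∈ restrictSupport R (Set.range ld)ᶜ) :
    c = 0 := by
  classical
  by_contra hne
  obtain ⟨p, hp, hmax⟩ := c.support.exists_max_image (fun p => rk (ld p))
    (Finsupp.support_nonempty_iff.2 hne)
  have hcoeff : ∀ q ∈ c.support, coeff (ld p) (b q) = if q = p then 1 else 0 := by
    intro q hq
    have h := coeff_eq_zero_of_mem_restrictSupport (hb q) (m := ld p) (hmax q hq).not_gt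
    rw [coeff_sub, sub_eq_zero, coeff_monomial] at h
    simpa only [hld.eq_iff] using h
  have h := coeff_eq_zero_of_mem_restrictSupport hc (m := ld p) (by simp)
  rw [Finsupp.linearCombination_apply, Finsupp.sum, coeff_sum, Finset.sum_eq_single p] at h
  · rw [coeff_smul, hcoeff p hp, if_pos rfl, smul_eq_mul, mul_one] at h
    exact Finsupp.mem_support_iff.1 hp h
  · intro q hq hqp
    rw [coeff_smul, hcoeff q hq, if_neg hqp, smul_zero]
  · exact fun h => absurd hp h

end Triangular

section Tanisaki

variable {n : ℕ} {F : Type*} [Field F]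

theorem isUpperSet_card_support (h : ℕ) :
    IsUpperSet {m : Fin n →₀ ℕ | h ≤ m.support.card} := fun _ _ hle hm =>
  le_trans (α := ℕ) hm (Finset.card_le_card (Finsupp.support_mono hle))

theorem dk_eq_of_hook {h k : ℕ} (hh : 1 ≤ h) (hhn : h ≤ n) (hk : k ≤ n) {μ : n.Partition}
    (hμ : μ.parts = (n - h + 1) ::ₘ Multiset.replicate (h - 1) 1) :
    dk n μ k = (k + 1 - h) + if k = n then h - 1 else 0 := by
  have hcard : ∀ i ∈ Finset.Icc (n + 1 - k) n, (μ.parts.filter fun p => i ≤ p).card =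
      (if i ≤ n - h + 1 then 1 else 0) + if i = 1 then h - 1 else 0 := by
    intro i hi
    rw [Finset.mem_Icc] at hi
    rw [hμ, ← Multiset.countP_eq_card_filter, Multiset.countP_cons, Multiset.countP_eq_card_filter,
      add_comm]
    congr 1
    by_cases h₁ : i = 1
    · rw [if_pos h₁, Multiset.filter_eq_self.2, Multiset.card_replicate]
      intro p hp
      rw [Multiset.eq_of_mem_replicate hp, h₁]
    · rw [if_neg h₁, Multiset.filter_eq_nil.2, Multiset.card_zero]
      intro p hp
      rw [Multiset.eq_of_mem_replicate hp]
      omega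
  have hfilter : (Finset.Icc (n + 1 - k) n).filter (· ≤ n - h + 1) =
      Finset.Icc (n + 1 - k) (n - h + 1) := by
    ext i
    simp only [Finset.mem_filter, Finset.mem_Icc]
    omega
  rw [dk, Finset.sum_congr rfl hcard, Finset.sum_add_distrib, Finset.sum_boole, hfilter,
    Nat.card_Icc, Finset.sum_ite_eq']
  simp only [Finset.mem_Icc, Nat.cast_id]
  split_ifs <;> omega

theorem esymmS_card (T : Finset (Fin n)) : esymmS F T T.card = monomial (indExp T) 1 := by
  rw [esymmS_eq_sum_monomial, Finset.powersetCard_self, Finset.sum_singleton]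

theorem esymmS_mem_restrictSupport {h r : ℕ} (hr : h ≤ r) (S : Finset (Fin n)) :
    esymmS F S r ∈ restrictSupport F {m | h ≤ m.support.card} := by
  rw [esymmS_eq_sum_monomial]
  refine Submodule.sum_mem _ fun T hT => (monomial_mem_restrictSupport F).2 (Or.inl ?_)
  rw [Set.mem_ofPred_eq, support_indExp, (Finset.mem_powersetCard.1 hT).2]
  exact hr

theorem tanisaki_eq_of_hook {h : ℕ} (hh : 1 ≤ h) (hhn : h ≤ n) {μ : n.Partition}
    (hμ : μ.parts = (n - h + 1) ::ₘ Multiset.replicate (h - 1) 1) :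
    tanisaki n F μ = restrictSupportIdeal F _ (isUpperSet_card_support h) ⊔
      Ideal.span (Set.range fun r : Fin (h - 1) => esymmS F Finset.univ (r + 1)) := by
  refine le_antisymm (Ideal.span_le.2 ?_) (sup_le (fun f hf => ?_) (Ideal.span_le.2 ?_))
  · rintro _ ⟨k, r, S, hS, hrk, hkr, rfl⟩
    have hkn : k ≤ n := hS ▸ card_finset_fin_le S
    rw [dk_eq_of_hook hh hhn hkn hμ] at hkr
    by_cases hr : h ≤ r
    · exact Ideal.mem_sup_left (esymmS_mem_restrictSupport hr S)
    · have hk : k = n := by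
        by_contra hk
        rw [if_neg hk] at hkr
        omega
      rw [if_pos hk] at hkr
      rw [(Finset.card_eq_iff_eq_univ S).1 (by rw [hS, hk, Fintype.card_fin])]
      refine Ideal.mem_sup_right (Ideal.subset_span ⟨⟨r - 1, by omega⟩, ?_⟩)
      simp only
      rw [Nat.sub_add_cancel (by omega)]
  · have hle : restrictSupport F {m | h ≤ m.support.card} ≤
        (tanisaki n F μ).restrictScalars F := by
      rw [restrictSupport_eq_span, Submodule.span_le]
      rintro _ ⟨m, hm, rfl⟩
      obtain ⟨T, hTm, hT⟩ := Finset.exists_subset_card_eq hm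
      have hTle : indExp T ≤ m := fun x => by
        rw [indExp_apply]
        split_ifs with hx
        · exact Nat.one_le_iff_ne_zero.2 (Finsupp.mem_support_iff.1 (hTm hx))
        · exact Nat.zero_le _
      have hmem : monomial (indExp T) (1 : F) ∈ tanisaki n F μ := by
        rw [← esymmS_card, hT]
        refine Ideal.subset_span ⟨h, h, T, hT, le_rfl, ?_, rfl⟩
        rw [dk_eq_of_hook hh hhn hhn hμ]
        omega
      have := Ideal.mul_mem_left _ (monomial (m - indExp T) (1 : F)) hmem
      rwa [monomial_mul, one_mul, tsub_add_cancel_of_le hTle] at this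
    exact hle hf
  · rintro _ ⟨r, rfl⟩
    refine Ideal.subset_span ⟨n, r + 1, Finset.univ, by simp, by omega, ?_, rfl⟩
    rw [dk_eq_of_hook hh hhn le_rfl hμ, if_pos rfl]
    omega

theorem rename_esymmS_univ (v : Equiv.Perm (Fin n)) (r : ℕ) :
    rename v (esymmS F Finset.univ r) = esymmS F Finset.univ r :=
  rename_esymm (Fin n) F r v

theorem IsDemazure.demBar_mem_tanisaki
    {dem : ℕ → MvPolynomial (Fin n) F → MvPolynomial (Fin n) F} (hdem : IsDemazure dem) {h : ℕ}
    (hh : 1 ≤ h) (hhn : h ≤ n) {μ : n.Partition}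
    (hμ : μ.parts = (n - h + 1) ::ₘ Multiset.replicate (h - 1) 1) {i : ℕ} (hi : i + 1 < n)
    {f : MvPolynomial (Fin n) F} (hf : f ∈ tanisaki n F μ) :
    demBar dem i f ∈ tanisaki n F μ := by
  rw [tanisaki_eq_of_hook hh hhn hμ] at hf ⊢
  obtain ⟨p, hp, q, hq, rfl⟩ := Submodule.mem_sup.1 hf
  obtain ⟨c, rfl⟩ := Ideal.mem_span_range_iff_exists_fun.1 hq
  rw [← hdem.demBarLinearMap_apply hi, map_add, map_sum]
  refine Ideal.add_mem _ (Ideal.mem_sup_left ?_) (Ideal.mem_sup_right ?_)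
  · exact hdem.demBar_mem_restrictSupport hi
      (fun m hm i j t hij ht => le_trans (α := ℕ) hm (card_support_le_moveExp hij ht)) hp
  · refine Ideal.sum_mem _ fun r _ => ?_
    rw [mul_comm, hdem.demBarLinearMap_apply,
      hdem.demBar_mul_of_rename_eq hi (rename_esymmS_univ _ _)]
    exact Ideal.mul_mem_right _ _ (Ideal.subset_span ⟨r, rfl⟩)

end Tanisaki

section Basis

variable {n : ℕ} {F : Type*} [Field F] {dem : ℕ → MvPolynomial (Fin n) F → MvPolynomial (Fin n) F}
  {a : Equiv.Perm (Fin n) → MvPolynomial (Fin n) F}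

/-- The indices of the basis of `F[x]` modulo the monomials with more than `k` variables. -/
abbrev AtomIndex (n k : ℕ) : Type :=
  {w : Equiv.Perm (Fin n) // permDes w ⊆ Finset.range k} × (Fin k → ℕ)

/-- The products of atoms and elementary symmetric polynomials. -/
noncomputable def atomSymm (a : Equiv.Perm (Fin n) → MvPolynomial (Fin n) F) {k : ℕ}
    (p : AtomIndex n k) : MvPolynomial (Fin n) F := a p.1 * symProd F n p.2

theorem symProd_zero (k : ℕ) : symProd F n (0 : Fin k → ℕ) = 1 := by
  simp [symProd]

theorem symProd_add_single {k : ℕ} (ν : Fin k → ℕ) (r : Fin k) :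
    symProd F n (ν + Pi.single r 1) = esymmS F Finset.univ (r + 1) * symProd F n ν := by
  simp only [symProd, Pi.add_apply, pow_add, Finset.prod_mul_distrib]
  rw [mul_comm, Finset.prod_eq_single r]
  · rw [Pi.single_eq_same, pow_one]
  · intro s _ hs
    rw [Pi.single_eq_of_ne hs, pow_zero]
  · exact fun h => absurd (Finset.mem_univ r) h

theorem range_ldExp {k : ℕ} (hk : k < n) :
    Set.range (fun p : AtomIndex n k => ldExp p.1.1 p.2) = {m | k + 1 ≤ m.support.card}ᶜ := by
  ext m
  rw [Set.mem_compl_iff, Set.mem_ofPred_eq, not_le, Nat.lt_succ_iff]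
  constructor
  · rintro ⟨p, rfl⟩
    exact card_support_ldExp_le hk.le p.1.2 p.2
  · intro hm
    obtain ⟨w, ν, hw, rfl⟩ := exists_ldExp_eq hk hm
    exact ⟨⟨⟨w, hw⟩, ν⟩, rfl⟩

namespace IsAtomFamily

variable (ha : IsAtomFamily dem a) (hdem : IsDemazure dem) {k : ℕ} (hk : k < n)

include ha hdem hk

theorem span_atomSymm_sup_eq_top :
    Submodule.span F (Set.range (atomSymm (k := k) a)) ⊔
      restrictSupport F {m | k + 1 ≤ m.support.card} = ⊤ := by
  have h := span_range_sup_restrictSupport_eq_top (R := F) (rk := expRank)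
    (ld := fun p : AtomIndex n k => ldExp p.1.1 p.2) (b := atomSymm a)
    fun p => ha.mul_symProd_sub_mem hdem p.1 hk.le p.2
  rwa [range_ldExp hk, compl_compl] at h

theorem eq_zero_of_linearCombination_atomSymm_mem {c : AtomIndex n k →₀ F}
    (hc : Finsupp.linearCombination F (atomSymm a) c ∈
      restrictSupport F {m | k + 1 ≤ m.support.card}) : c = 0 := by
  refine eq_zero_of_linearCombination_mem_restrictSupport (rk := expRank)
    (ld := fun p : AtomIndex n k => ldExp p.1.1 p.2) (b := atomSymm a) ?_
    (fun p => ha.mul_symProd_sub_mem hdem p.1 hk.le p.2) ?_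
  · intro p q hpq
    obtain ⟨h₁, h₂⟩ := ldExp_injective hk hpq
    exact Prod.ext (Subtype.ext h₁) h₂
  · rwa [range_ldExp hk, compl_compl]

theorem esymmS_mul_mem (r : Fin k) (f : MvPolynomial (Fin n) F) :
    esymmS F Finset.univ (r + 1) * f ∈
      Submodule.span F (atomSymm a '' {p : AtomIndex n k | p.2 ≠ 0}) ⊔
        restrictSupport F {m | k + 1 ≤ m.support.card} := by
  set N := Submodule.span F (atomSymm a '' {p : AtomIndex n k | p.2 ≠ 0}) ⊔
    restrictSupport F {m | k + 1 ≤ m.support.card}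
  have hle : Submodule.span F (Set.range (atomSymm (k := k) a)) ⊔
      restrictSupport F {m | k + 1 ≤ m.support.card} ≤
        N.comap (LinearMap.mulLeft F (esymmS F Finset.univ (r + 1))) := by
    refine sup_le (Submodule.span_le.2 ?_) fun q hq => ?_
    · rintro _ ⟨⟨w, ν⟩, rfl⟩
      refine Submodule.mem_sup_left (Submodule.subset_span ⟨⟨w, ν + Pi.single r 1⟩, ?_, ?_⟩)
      · intro h
        have := congrFun h r
        simp at this
      · rw [atomSymm, symProd_add_single, mul_left_comm]
        rfl
    · exact Submodule.mem_sup_right ((restrictSupportIdeal F _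
        (isUpperSet_card_support (k + 1))).mul_mem_left _ hq)
  have hf : f ∈ Submodule.span F (Set.range (atomSymm (k := k) a)) ⊔
      restrictSupport F {m | k + 1 ≤ m.support.card} := by
    rw [ha.span_atomSymm_sup_eq_top hdem hk]
    exact Submodule.mem_top
  exact hle hf

theorem linearIndependent_mk {I : Ideal (MvPolynomial (Fin n) F)}
    (hI : I = restrictSupportIdeal F _ (isUpperSet_card_support (k + 1)) ⊔
      Ideal.span (Set.range fun r : Fin k => esymmS F Finset.univ (r + 1))) :
    LinearIndependent F
      (fun w : {w : Equiv.Perm (Fin n) // permDes w ⊆ Finset.range k} =>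
        Ideal.Quotient.mk I (a w)) := by
  classical
  rw [linearIndependent_iff]
  intro c hc
  have hsum : Finsupp.linearCombination F (fun w : {w // permDes w ⊆ Finset.range k} => a w) c ∈
      I := by
    rw [← Ideal.Quotient.eq_zero_iff_mem, ← hc]
    exact Finsupp.apply_linearCombination F (Ideal.Quotient.mkₐ F I).toLinearMap _ c
  have hmem : Finsupp.linearCombination F (fun w : {w // permDes w ⊆ Finset.range k} => a w) c ∈
      Submodule.span F (atomSymm a '' {p : AtomIndex n k | p.2 ≠ 0}) ⊔
        restrictSupport F {m | k + 1 ≤ m.support.card} := by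
    rw [hI] at hsum
    obtain ⟨p, hp, q, hq, hpq⟩ := Submodule.mem_sup.1 hsum
    obtain ⟨d, rfl⟩ := Ideal.mem_span_range_iff_exists_fun.1 hq
    rw [← hpq]
    refine Submodule.add_mem _ (Submodule.mem_sup_right hp) (Submodule.sum_mem _ fun r _ => ?_)
    rw [mul_comm]
    exact ha.esymmS_mul_mem hdem hk r (d r)
  obtain ⟨x, hx, y, hy, hxy⟩ := Submodule.mem_sup.1 hmem
  obtain ⟨d, hd, rfl⟩ := (Finsupp.mem_span_image_iff_linearCombination F).1 hx
  have hinj : Function.Injective fun w : {w : Equiv.Perm (Fin n) // permDes w ⊆ Finset.range k} =>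
      ((w, 0) : AtomIndex n k) := fun v w h => congrArg Prod.fst h
  have hzero := ha.eq_zero_of_linearCombination_atomSymm_mem hdem hk
    (c := c.mapDomain (fun w => (w, 0)) - d) (by
      have hcomp : atomSymm a ∘ (fun w => ((w, 0) : AtomIndex n k)) = fun w => a w.1 := by
        ext1 w
        rw [Function.comp_apply, atomSymm, symProd_zero, mul_one]
      rw [map_sub, Finsupp.linearCombination_mapDomain, hcomp, ← hxy, add_sub_cancel_left]
      exact hy)
  ext w
  have hw := DFunLike.congr_fun hzero (w, 0)
  rw [Finsupp.sub_apply, Finsupp.mapDomain_apply hinj, Finsupp.zero_apply, sub_eq_zero] at hw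
  rw [hw, Finsupp.zero_apply]
  by_contra h
  exact hd (Finsupp.mem_support_iff.2 h) rfl

theorem span_mk_eq_top {I : Ideal (MvPolynomial (Fin n) F)}
    (hI : I = restrictSupportIdeal F _ (isUpperSet_card_support (k + 1)) ⊔
      Ideal.span (Set.range fun r : Fin k => esymmS F Finset.univ (r + 1))) :
    Submodule.span F (Set.range
      (fun w : {w : Equiv.Perm (Fin n) // permDes w ⊆ Finset.range k} =>
        Ideal.Quotient.mk I (a w))) = ⊤ := by
  set N := Submodule.span F (Set.range
      (fun w : {w : Equiv.Perm (Fin n) // permDes w ⊆ Finset.range k} =>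
        Ideal.Quotient.mk I (a w)))
  have hle : Submodule.span F (Set.range (atomSymm (k := k) a)) ⊔
      restrictSupport F {m | k + 1 ≤ m.support.card} ≤
        N.comap (Ideal.Quotient.mkₐ F I).toLinearMap := by
    have hzero : ∀ f ∈ I, f ∈ N.comap (Ideal.Quotient.mkₐ F I).toLinearMap := by
      intro f hf
      rw [Submodule.mem_comap]
      convert Submodule.zero_mem N
      exact Ideal.Quotient.eq_zero_iff_mem.2 hf
    refine sup_le (Submodule.span_le.2 ?_) fun q hq => hzero q ?_
    · rintro _ ⟨⟨w, ν⟩, rfl⟩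
      by_cases hν : ν = 0
      · refine Submodule.subset_span ⟨w, ?_⟩
        simp [atomSymm, symProd_zero, hν]
      · obtain ⟨r, hr⟩ := Function.ne_iff.1 hν
        refine hzero _ ?_
        rw [hI]
        refine Ideal.mem_sup_right (Ideal.mul_mem_left _ _ (Ideal.mem_of_dvd _
          ((dvd_pow_self _ hr).trans (Finset.dvd_prod_of_mem _ (Finset.mem_univ r)))
          (Ideal.subset_span ⟨r, rfl⟩)))
    · rw [hI]
      exact Ideal.mem_sup_left hq
  rw [ha.span_atomSymm_sup_eq_top hdem hk] at hle
  rw [eq_top_iff]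
  rintro x -
  obtain ⟨f, rfl⟩ := Ideal.Quotient.mk_surjective x
  exact hle (Submodule.mem_top (x := f))

end IsAtomFamily

end Basis

/-- **Theorem 8.2** (realized on the Demazure atom basis).  Let `μ = (1^{h-1}, n-h+1)` be a
hook with `h` parts.  Each `π̄_i` preserves `I_μ` and hence induces an operator on
`R_μ = F[x]/I_μ`.  For `I ⊆ {1, …, h-1}` let `M_I` be the span in `R_μ` of the images of
the Demazure atoms `π̄_w(x_I)` with `D(w) = I`.  Then these images form an `F`-basis of
`M_I`, each `M_I` is invariant under the induced operators `π̄_i`, and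
`R_μ = ⨁_{I ⊆ {1,…,h-1}} M_I`.  (Here `a w = π̄_w(x_{D(w)})` via any reduced word of `w`,
with `π_i` characterized by `(x_i - x_{i+1}) π_i f = x_i f - x_{i+1} s_i(f)`,
`π̄_i = π_i - 1`.) -/
theorem stmt_19 (n : ℕ) (hn : 1 ≤ n) (F : Type*) [Field F] (h : ℕ)
    (hh : 1 ≤ h) (hhn : h ≤ n) (μ : n.Partition)
    (hμ : μ.parts = (n - h + 1) ::ₘ Multiset.replicate (h - 1) 1)
    (dem : ℕ → MvPolynomial (Fin n) F → MvPolynomial (Fin n) F)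
    (hdem : ∀ (i : ℕ) (hi : i + 1 < n) (f : MvPolynomial (Fin n) F),
      (X (⟨i, Nat.lt_of_succ_lt hi⟩ : Fin n) - X ⟨i + 1, hi⟩) * dem i f
        = X (⟨i, Nat.lt_of_succ_lt hi⟩ : Fin n) * f - X ⟨i + 1, hi⟩ * rename (sw n i) f)
    (a : Equiv.Perm (Fin n) → MvPolynomial (Fin n) F)
    (ha : ∀ w : Equiv.Perm (Fin n), ∃ l : List ℕ,
      (∀ i ∈ l, i + 1 < n) ∧ (l.map (sw n)).prod = w ∧ l.length = invNum w ∧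
      a w = l.foldr (fun i f => dem i f - f) (xI F n (permDes w)))
    (M : Finset ℕ → Submodule F (MvPolynomial (Fin n) F ⧸ tanisaki n F μ))
    (hM : ∀ I : Finset ℕ, M I = Submodule.span F
      ((fun w => Ideal.Quotient.mk (tanisaki n F μ) (a w)) ''
        {w : Equiv.Perm (Fin n) | permDes w = I})) :
    (∀ i : ℕ, i + 1 < n → ∀ f ∈ tanisaki n F μ, dem i f - f ∈ tanisaki n F μ) ∧
    (∀ I : Finset ℕ, I ⊆ Finset.range (h - 1) →
      LinearIndependent F (fun w : {w : Equiv.Perm (Fin n) // permDes w = I} =>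
        Ideal.Quotient.mk (tanisaki n F μ) (a w.val))) ∧
    (∀ I : Finset ℕ, I ⊆ Finset.range (h - 1) → ∀ i : ℕ, i + 1 < n →
      ∀ f : MvPolynomial (Fin n) F, Ideal.Quotient.mk (tanisaki n F μ) f ∈ M I →
        Ideal.Quotient.mk (tanisaki n F μ) (dem i f - f) ∈ M I) ∧
    iSupIndep (fun I : {I : Finset ℕ // I ⊆ Finset.range (h - 1)} => M I.val) ∧
    (⨆ I : {I : Finset ℕ // I ⊆ Finset.range (h - 1)}, M I.val) = ⊤ := by
  obtain ⟨k, rfl⟩ : ∃ k, h = k + 1 := ⟨h - 1, by omega⟩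
  rw [Nat.add_sub_cancel]
  have hdem : IsDemazure dem := hdem
  have ha : IsAtomFamily dem a := fun w => by
    obtain ⟨l, hl, hw, hlen, haw⟩ := ha w
    exact ⟨l, ⟨hl, hlen.trans (congrArg invNum hw.symm)⟩, hw, haw⟩
  have hI := tanisaki_eq_of_hook (F := F) hh hhn hμ
  have hpres : ∀ i : ℕ, i + 1 < n → ∀ f ∈ tanisaki n F μ, demBar dem i f ∈ tanisaki n F μ :=
    fun i hi f => hdem.demBar_mem_tanisaki hh hhn hμ hi
  have hli := ha.linearIndependent_mk hdem (Nat.lt_of_succ_le hhn) hI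
  have hspan := ha.span_mk_eq_top hdem (Nat.lt_of_succ_le hhn) hI
  set v := fun w : {w : Equiv.Perm (Fin n) // permDes w ⊆ Finset.range k} =>
    Ideal.Quotient.mk (tanisaki n F μ) (a w)
  have hMv : ∀ I : Finset ℕ, I ⊆ Finset.range k →
      M I = Submodule.span F (v '' {w | permDes w.1 = I}) := by
    intro I hIk
    rw [hM]
    congr 1
    ext x
    constructor
    · rintro ⟨w, rfl, rfl⟩
      exact ⟨⟨w, hIk⟩, rfl, rfl⟩
    · rintro ⟨w, hw, rfl⟩
      exact ⟨w.1, hw, rfl⟩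
  refine ⟨hpres, fun I hIk => ?_, fun I hIk i hi f hf => ?_, fun I => ?_, ?_⟩
  · exact hli.comp
      (fun w : {w : Equiv.Perm (Fin n) // permDes w = I} => ⟨w.1, w.2.symm ▸ hIk⟩)
      fun w w' hww => Subtype.ext (congrArg (fun u => u.1) hww)
  · have himage : (fun w => Ideal.Quotient.mk (tanisaki n F μ) (a w)) '' {w | permDes w = I} =
        (Ideal.Quotient.mkₐ F (tanisaki n F μ)).toLinearMap '' (a '' {w | permDes w = I}) := by
      rw [Set.image_image]
      rfl
    rw [hM, himage, Submodule.span_image] at hf ⊢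
    obtain ⟨g, hg, hgf⟩ := hf
    have hsub : demBar dem i g - demBar dem i f ∈ tanisaki n F μ := by
      rw [← hdem.demBarLinearMap_apply hi, ← hdem.demBarLinearMap_apply hi, ← map_sub]
      exact hpres i hi _ (Ideal.Quotient.eq.1 hgf)
    refine ⟨demBar dem i g, ?_, Ideal.Quotient.eq.2 hsub⟩
    have hle : Submodule.span F (a '' {w | permDes w = I}) ≤
        (Submodule.span F (a '' {w | permDes w = I})).comap (hdem.demBarLinearMap hi) := by
      rw [Submodule.span_le]
      rintro _ ⟨w, rfl, rfl⟩
      exact ha.demBar_mem_span hdem hi w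
    exact hle hg
  · beta_reduce
    rw [hMv I.1 I.2]
    refine (hli.disjoint_span_image (t := {w | permDes w.1 ≠ I.1}) ?_).mono_right ?_
    · exact Set.disjoint_left.2 fun w hw hw' => hw' hw
    · refine iSup₂_le fun J hJ => ?_
      rw [hMv J.1 J.2]
      refine Submodule.span_mono (Set.image_mono fun w hw hwI => hJ (Subtype.ext ?_))
      exact hw.symm.trans hwI
  · rw [eq_top_iff, ← hspan, Submodule.span_le]
    rintro _ ⟨w, rfl⟩
    refine Submodule.mem_iSup_of_mem ⟨permDes w.1, w.2⟩ ?_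
    rw [hMv _ w.2]
    exact Submodule.subset_span ⟨w, rfl, rfl⟩
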